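/- arXiv:2102.10093 — 4 statements merged into one kernel-verified Lean document; each statement's English description precedes it below -/
import Mathlib

section
/- Let w ∈ {1,2,3}^ℕ be a C-adic word with directive sequence (σ_n) ∈ {c1,c2}^ℕ and let (M_n) be the associated sequence of incidence matrices. Then w has uniform word frequencies: for every finite word u occurring in w, the ratio |w_k w_{k+1} ⋯ w_{k+n−1}|_u / n converges as n → ∞, uniformly in k. Moreover, if f ∈ Δ satisfies ⋂_{n≥0} M_{[0,n)} ℝ³_{≥0} = ℝ_{≥0} f, then for each letter a ∈ {1,2,3} the frequency of a in w equals f_a, i.e., |w_k w_{k+1} ⋯ w_{k+n−1}|_a / n → f_a as n → ∞, uniformly in k. -/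
open Matrix Filter MeasureTheory

noncomputable section

/-- The matrix `C1`. -/
def C1 : Matrix (Fin 3) (Fin 3) ℝ := !![1,1,0; 0,0,1; 0,1,0]

/-- The matrix `C2`. -/
def C2 : Matrix (Fin 3) (Fin 3) ℝ := !![0,1,0; 1,0,0; 0,1,1]

/-- The product `M 0 * M 1 * ... * M (n-1)`. -/
def pprod (M : ℕ → Matrix (Fin 3) (Fin 3) ℝ) (n : ℕ) : Matrix (Fin 3) (Fin 3) ℝ :=
  ((List.range n).map M).prod

/-- The image of the nonnegative orthant under `M`. -/
def cone (M : Matrix (Fin 3) (Fin 3) ℝ) : Set (Fin 3 → ℝ) :=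
  {y | ∃ x : Fin 3 → ℝ, (∀ i, 0 ≤ x i) ∧ y = M.mulVec x}

/-- The ray generated by `f`. -/
def ray (f : Fin 3 → ℝ) : Set (Fin 3 → ℝ) := {y | ∃ t : ℝ, 0 ≤ t ∧ y = t • f}

/-- The simplex of nonnegative vectors whose entries sum to 1. -/
def simplex : Set (Fin 3 → ℝ) := {x | (∀ i, 0 ≤ x i) ∧ x 0 + x 1 + x 2 = 1}

/-- The matrix indexed by an element of `{1,2}` (encoded as `Fin 2`). -/
def cMat : Fin 2 → Matrix (Fin 3) (Fin 3) ℝ := ![C1, C2]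

/-- The substitution `c1 : 1 ↦ 1, 2 ↦ 13, 3 ↦ 2` (letters `1,2,3` encoded as `0,1,2 : Fin 3`). -/
def c1 : Fin 3 → List (Fin 3) := ![[0], [0, 2], [1]]

/-- The substitution `c2 : 1 ↦ 2, 2 ↦ 13, 3 ↦ 3`. -/
def c2 : Fin 3 → List (Fin 3) := ![[1], [0, 2], [2]]

/-- The substitution indexed by an element of `{1,2}` (encoded as `Fin 2`). -/
def cSub : Fin 2 → (Fin 3 → List (Fin 3)) := ![c1, c2]

/-- Application of a substitution to a word. -/
def subApply (σ : Fin 3 → List (Fin 3)) (w : List (Fin 3)) : List (Fin 3) :=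
  w.flatMap σ

/-- `dirProd σ n a` is the word `σ 0 ∘ σ 1 ∘ ... ∘ σ (n-1) (a)`. -/
def dirProd (σ : ℕ → (Fin 3 → List (Fin 3))) : ℕ → Fin 3 → List (Fin 3)
  | 0 => fun a => [a]
  | n + 1 => fun a => subApply (dirProd σ n) (σ n a)

/-- `LimitWord σ a w`: the words `σ 0 ∘ ... ∘ σ (n-1) (a n)` converge to the
infinite word `w`, i.e. for every `k` and all large enough `n`, the first `k`
letters of that word are defined and agree with `w`. -/
def LimitWord (σ : ℕ → (Fin 3 → List (Fin 3))) (a : ℕ → Fin 3) (w : ℕ → Fin 3) : Prop :=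
  ∀ k : ℕ, ∃ N : ℕ, ∀ n ≥ N,
    k ≤ (dirProd σ n (a n)).length ∧ ∀ j < k, (dirProd σ n (a n))[j]? = some (w j)

/-- The factor `w k, w (k+1), ..., w (k+n-1)` of an infinite word `w`. -/
def win (w : ℕ → Fin 3) (k n : ℕ) : List (Fin 3) :=
  (List.range n).map (fun j => w (k + j))

/-- The number of occurrences of the word `u` in the word `v`. -/
def occ (u v : List (Fin 3)) : ℕ :=
  (List.range (v.length + 1)).countP (fun j => decide (u <+: v.drop j))

/-! ### Words, block decompositions and occurrences -/

/-- The substitution `cSub (i 0) ∘ ⋯ ∘ cSub (i (n - 1))`. -/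
abbrev blockMap (i : ℕ → Fin 2) (n : ℕ) : Fin 3 → List (Fin 3) :=
  dirProd (fun m => cSub (i m)) n

/-- The factors of the words `blockMap i n a`. -/
def language (i : ℕ → Fin 2) : Set (List (Fin 3)) :=
  {v | ∃ n a, v <:+: blockMap i n a}

/-- A real function on words that is additive under concatenation up to an error `K`. -/
def QuasiAdditive (K : ℝ) (φ : List (Fin 3) → ℝ) : Prop :=
  ∀ x y, |φ (x ++ y) - φ x - φ y| ≤ K

theorem subApply_append (τ : Fin 3 → List (Fin 3)) (x y : List (Fin 3)) :
    subApply τ (x ++ y) = subApply τ x ++ subApply τ y := by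
  simp [subApply]

theorem dirProd_add (σ : ℕ → Fin 3 → List (Fin 3)) (m n : ℕ) (a : Fin 3) :
    dirProd σ (m + n) a = subApply (dirProd σ m) (dirProd (fun k => σ (m + k)) n a) := by
  induction n generalizing a with
  | zero => simp [dirProd, subApply]
  | succ n ih =>
    change subApply (dirProd σ (m + n)) (σ (m + n) a) = _
    rw [show dirProd σ (m + n) = _ from funext ih]
    simp [dirProd, subApply, List.flatMap_assoc]

theorem eq_zero_or_eq_one (x : Fin 2) : x = 0 ∨ x = 1 := by
  fin_cases x <;> simp

theorem blockMap_succ_of_eq_zero {i : ℕ → Fin 2} {n : ℕ} (h : i n = 0) :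
    blockMap i (n + 1) = ![blockMap i n 0, blockMap i n 0 ++ blockMap i n 2, blockMap i n 1] := by
  funext a
  fin_cases a <;> simp [blockMap, dirProd, subApply, h, cSub, c1]

theorem blockMap_succ_of_eq_one {i : ℕ → Fin 2} {n : ℕ} (h : i n = 1) :
    blockMap i (n + 1) = ![blockMap i n 1, blockMap i n 0 ++ blockMap i n 2, blockMap i n 2] := by
  funext a
  fin_cases a <;> simp [blockMap, dirProd, subApply, h, cSub, c2]

theorem one_le_length_blockMap (i : ℕ → Fin 2) (n : ℕ) (a : Fin 3) :
    1 ≤ (blockMap i n a).length := by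
  induction n generalizing a with
  | zero => simp [blockMap, dirProd]
  | succ n ih =>
    have h0 := ih 0
    have h1 := ih 1
    have h2 := ih 2
    rcases eq_zero_or_eq_one (i n) with h | h
    · rw [blockMap_succ_of_eq_zero h]
      fin_cases a <;> simp <;> omega
    · rw [blockMap_succ_of_eq_one h]
      fin_cases a <;> simp <;> omega

theorem length_blockMap_le (i : ℕ → Fin 2) (n : ℕ) (a : Fin 3) :
    (blockMap i n a).length ≤ 2 ^ n := by
  induction n generalizing a with
  | zero => simp [blockMap, dirProd]
  | succ n ih =>
    have h0 := ih 0
    have h1 := ih 1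
    have h2 := ih 2
    rcases eq_zero_or_eq_one (i n) with h | h
    · rw [blockMap_succ_of_eq_zero h, pow_succ]
      fin_cases a <;> simp <;> omega
    · rw [blockMap_succ_of_eq_one h, pow_succ]
      fin_cases a <;> simp <;> omega

theorem prefix_append_cases {v x y : List (Fin 3)} (h : v <+: x ++ y) :
    v <+: x ∨ ∃ v₁, v = x ++ v₁ ∧ v₁ <+: y := by
  obtain ⟨r, hr⟩ := h
  rcases List.append_eq_append_iff.1 hr with ⟨z, h1, -⟩ | ⟨z, h1, h2⟩
  · exact Or.inl ⟨z, h1.symm⟩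
  · exact Or.inr ⟨z, h1, r, h2.symm⟩

theorem suffix_append_cases {v x y : List (Fin 3)} (h : v <:+ x ++ y) :
    v <:+ y ∨ ∃ v₁, v = v₁ ++ y ∧ v₁ <:+ x := by
  obtain ⟨r, hr⟩ := h
  rcases List.append_eq_append_iff.1 hr with ⟨z, h1, h2⟩ | ⟨z, h1, h2⟩
  · exact Or.inr ⟨z, h2, r, h1.symm⟩
  · exact Or.inl ⟨z, h2.symm⟩

theorem exists_prefix_of_prefix_subApply {τ : Fin 3 → List (Fin 3)} {B : ℕ}
    (hB : ∀ a, (τ a).length ≤ B) {t v : List (Fin 3)} (h : v <+: subApply τ t) :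
    ∃ v' p, v' <+: t ∧ v = subApply τ v' ++ p ∧ p.length ≤ B := by
  induction t generalizing v with
  | nil =>
    refine ⟨[], [], by simp, ?_, by simp⟩
    simpa [subApply] using h
  | cons a t ih =>
    have e : subApply τ (a :: t) = τ a ++ subApply τ t := by simp [subApply]
    rw [e] at h
    rcases prefix_append_cases h with h | ⟨v₁, rfl, h'⟩
    · exact ⟨[], v, by simp, by simp [subApply], h.length_le.trans (hB a)⟩
    · obtain ⟨v', p, h1, rfl, h3⟩ := ih h'
      exact ⟨a :: v', p, by simpa using h1, by simp [subApply], h3⟩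

theorem exists_suffix_of_suffix_subApply {τ : Fin 3 → List (Fin 3)} {B : ℕ}
    (hB : ∀ a, (τ a).length ≤ B) {t v : List (Fin 3)} (h : v <:+ subApply τ t) :
    ∃ s t', t' <:+ t ∧ v = s ++ subApply τ t' ∧ s.length ≤ B := by
  induction t generalizing v with
  | nil =>
    refine ⟨[], [], by simp, ?_, by simp⟩
    simpa [subApply] using h
  | cons a t ih =>
    have e : subApply τ (a :: t) = τ a ++ subApply τ t := by simp [subApply]
    rw [e] at h
    rcases suffix_append_cases h with h | ⟨v₁, rfl, h'⟩
    · obtain ⟨s, t', h1, rfl, h3⟩ := ih h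
      exact ⟨s, t', h1.trans (List.suffix_cons a t), rfl, h3⟩
    · exact ⟨v₁, t, List.suffix_cons a t, rfl, h'.length_le.trans (hB a)⟩

theorem exists_infix_of_infix_subApply {τ : Fin 3 → List (Fin 3)} {B : ℕ}
    (hB : ∀ a, (τ a).length ≤ B) {t v : List (Fin 3)} (h : v <:+: subApply τ t) :
    ∃ s v' p, v' <:+: t ∧ v = s ++ subApply τ v' ++ p ∧ s.length ≤ B ∧ p.length ≤ B := by
  obtain ⟨r, hvr, hr⟩ := List.infix_iff_prefix_suffix.1 h
  obtain ⟨s, t', ht', rfl, hs⟩ := exists_suffix_of_suffix_subApply hB hr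
  rcases prefix_append_cases hvr with h' | ⟨v₁, rfl, h'⟩
  · exact ⟨v, [], [], List.nil_infix, by simp [subApply], h'.length_le.trans hs, by simp⟩
  · obtain ⟨v', p, h1, rfl, h3⟩ := exists_prefix_of_prefix_subApply hB h'
    exact ⟨s, v', p, h1.isInfix.trans ht'.isInfix, by simp, hs, h3⟩

theorem exists_desubstitution (i : ℕ → Fin 2) (m : ℕ) {v : List (Fin 3)} (hv : v ∈ language i) :
    ∃ s v' p, v' ∈ language (fun k => i (m + k)) ∧ v = s ++ subApply (blockMap i m) v' ++ p ∧
      s.length ≤ 2 ^ m ∧ p.length ≤ 2 ^ m := by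
  obtain ⟨n, a, h⟩ := hv
  rcases le_total m n with hmn | hmn
  · obtain ⟨n, rfl⟩ := Nat.exists_eq_add_of_le hmn
    rw [blockMap, dirProd_add] at h
    obtain ⟨s, v', p, h1, h2⟩ := exists_infix_of_infix_subApply (length_blockMap_le i m) h
    exact ⟨s, v', p, ⟨n, a, h1⟩, h2⟩
  · refine ⟨v, [], [], ⟨0, 0, List.nil_infix⟩, by simp [subApply], ?_, by simp⟩
    exact h.length_le.trans ((length_blockMap_le i n a).trans (Nat.pow_le_pow_right two_pos hmn))

theorem occ_cons (u v : List (Fin 3)) (a : Fin 3) :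
    occ u (a :: v) = (if u <+: a :: v then 1 else 0) + occ u v := by
  unfold occ
  rw [List.length_cons, List.range_succ_eq_map, List.countP_cons, List.countP_map, add_comm]
  simp [Function.comp_def]

theorem occ_append_le (u x y : List (Fin 3)) :
    occ u (x ++ y) ≤ occ u x + occ u y + min x.length u.length := by
  induction x with
  | nil => simp
  | cons a x ih =>
    rw [List.cons_append, occ_cons, occ_cons, List.length_cons]
    by_cases hu : u.length ≤ x.length + 1
    · have : u <+: a :: (x ++ y) ↔ u <+: a :: x := by
        rw [← List.cons_append]
        refine ⟨fun h => ?_, fun h => h.trans (List.prefix_append _ _)⟩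
        exact List.prefix_of_prefix_length_le h (List.prefix_append _ _) (by simpa using hu)
      simp only [this]
      omega
    · split_ifs <;> omega

theorem le_occ_append (u x y : List (Fin 3)) :
    occ u x + occ u y ≤ occ u (x ++ y) + 1 := by
  induction x with
  | nil =>
    have : occ u [] ≤ 1 := List.countP_le_length.trans (by simp)
    simp only [List.nil_append]
    omega
  | cons a x ih =>
    rw [List.cons_append, occ_cons, occ_cons]
    have : u <+: a :: x → u <+: a :: (x ++ y) := fun h => by
      rw [← List.cons_append]
      exact h.trans (List.prefix_append _ _)
    split_ifs <;> first | omega | tauto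

theorem quasiAdditive_occ (u : List (Fin 3)) :
    QuasiAdditive (u.length + 1) (fun v => (occ u v : ℝ)) := by
  intro x y
  have h1 : (occ u (x ++ y) : ℝ) ≤ occ u x + occ u y + u.length := by
    exact_mod_cast (occ_append_le u x y).trans (by simp)
  have h2 : (occ u x + occ u y : ℝ) ≤ occ u (x ++ y) + 1 := by
    exact_mod_cast le_occ_append u x y
  rw [abs_le]
  constructor <;> linarith [(Nat.cast_nonneg u.length : (0 : ℝ) ≤ _)]

theorem quasiAdditive_count (a : Fin 3) :
    QuasiAdditive 0 (fun v => (v.count a : ℝ)) := by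
  intro x y
  simp [List.count_append]

namespace QuasiAdditive

variable {K : ℝ} {φ : List (Fin 3) → ℝ}

theorem nonneg (hφ : QuasiAdditive K φ) : 0 ≤ K := (abs_nonneg _).trans (hφ [] [])

theorem abs_nil_le (hφ : QuasiAdditive K φ) : |φ []| ≤ K := by
  simpa using hφ [] []

theorem abs_subApply_sub_le (hφ : QuasiAdditive K φ) (τ : Fin 3 → List (Fin 3))
    (v : List (Fin 3)) :
    |φ (subApply τ v) - (v.map fun a => φ (τ a)).sum| ≤ K * v.length + K := by
  induction v with
  | nil => simpa [subApply] using hφ.abs_nil_le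
  | cons a v ih =>
    have e : subApply τ (a :: v) = τ a ++ subApply τ v := by simp [subApply]
    have h := hφ (τ a) (subApply τ v)
    rw [e, List.map_cons, List.sum_cons, List.length_cons]
    push_cast
    rw [abs_le] at *
    constructor <;> linarith

end QuasiAdditive

theorem sum_map_eq_sum_count (g : Fin 3 → ℝ) (v : List (Fin 3)) :
    (v.map g).sum = ∑ a, (v.count a : ℝ) * g a := by
  induction v with
  | nil => simp
  | cons b v ih =>
    simp [ih, List.count_cons, add_mul, Finset.sum_add_distrib, add_comm]

theorem exists_bound_of_length_le (φ : List (Fin 3) → ℝ) (B : ℕ) :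
    ∃ C, 0 ≤ C ∧ ∀ v : List (Fin 3), v.length ≤ B → |φ v| ≤ C := by
  obtain ⟨C, hC⟩ := ((List.finite_length_le (Fin 3) B).image fun v => |φ v|).bddAbove
  exact ⟨C, (abs_nonneg _).trans (hC ⟨[], by simp, rfl⟩), fun v hv => hC ⟨v, hv, rfl⟩⟩

/-! ### Contraction of the nested cones -/

/-- The columns of the products of the matrices `cMat (i n)`, tested against a linear form. -/
structure Evolves (i : ℕ → Fin 2) (h : ℕ → Fin 3 → ℝ) : Prop where
  of_eq_zero : ∀ n, i n = 0 → h (n + 1) = ![h n 0, h n 0 + h n 2, h n 1]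
  of_eq_one : ∀ n, i n = 1 → h (n + 1) = ![h n 1, h n 0 + h n 2, h n 2]

/-- The length of `blockMap i n a`, as a real number. -/
def blockLength (i : ℕ → Fin 2) (n : ℕ) (a : Fin 3) : ℝ := (blockMap i n a).length

theorem one_le_blockLength (i : ℕ → Fin 2) (n : ℕ) (a : Fin 3) : 1 ≤ blockLength i n a :=
  Nat.one_le_cast.2 (one_le_length_blockMap i n a)

theorem evolves_blockLength (i : ℕ → Fin 2) : Evolves i (blockLength i) := by
  constructor <;> intro n hn <;> funext a <;> unfold blockLength
  · rw [blockMap_succ_of_eq_zero hn]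
    fin_cases a <;> simp
  · rw [blockMap_succ_of_eq_one hn]
    fin_cases a <;> simp

theorem evolves_count (i : ℕ → Fin 2) (b : Fin 3) :
    Evolves i fun n a => ((blockMap i n a).count b : ℝ) := by
  constructor <;> intro n hn <;> funext a
  · rw [blockMap_succ_of_eq_zero hn]
    fin_cases a <;> simp
  · rw [blockMap_succ_of_eq_one hn]
    fin_cases a <;> simp

/-- The letter `1` always has the longest image, of length at most the sum of the other two. -/
theorem blockLength_balanced (i : ℕ → Fin 2) (n : ℕ) :
    blockLength i n 0 ≤ blockLength i n 1 ∧ blockLength i n 2 ≤ blockLength i n 1 ∧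
    blockLength i n 1 ≤ blockLength i n 0 + blockLength i n 2 := by
  induction n with
  | zero => simp [blockLength, blockMap, dirProd]
  | succ n ih =>
    have h0 := one_le_blockLength i n 0
    have h2 := one_le_blockLength i n 2
    rcases eq_zero_or_eq_one (i n) with h | h
    · rw [(evolves_blockLength i).of_eq_zero n h]
      simp
      exact ⟨by linarith, by linarith, by linarith⟩
    · rw [(evolves_blockLength i).of_eq_one n h]
      simp
      exact ⟨by linarith, by linarith, by linarith⟩

/-- The ratios `φ a / h a` all lie in `[m, M]`. -/
def Enclosed (h φ : Fin 3 → ℝ) (m M : ℝ) : Prop :=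
  ∀ a, m * h a ≤ φ a ∧ φ a ≤ M * h a

theorem Enclosed.mono {i : ℕ → Fin 2} {h φ : ℕ → Fin 3 → ℝ} (hh : Evolves i h)
    (hφ : Evolves i φ) {n k : ℕ} (hnk : n ≤ k) {m M : ℝ} (he : Enclosed (h n) (φ n) m M) :
    Enclosed (h k) (φ k) m M := by
  induction k, hnk using Nat.le_induction with
  | base => exact he
  | succ k _ ih =>
    have h0 := ih 0
    have h1 := ih 1
    have h2 := ih 2
    intro a
    rcases eq_zero_or_eq_one (i k) with hk | hk
    · rw [hh.of_eq_zero k hk, hφ.of_eq_zero k hk]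
      fin_cases a <;> simp <;> constructor <;> linarith
    · rw [hh.of_eq_one k hk, hφ.of_eq_one k hk]
      fin_cases a <;> simp <;> constructor <;> linarith

/-- If each of three new vectors is a sum of a multiple of a common vector `s` having at least a
quarter of the total height and of a vector of the old cone, then the enclosure shrinks. -/
theorem Enclosed.contract {h' φ' : Fin 3 → ℝ} {m M hs φs : ℝ} (hpos : 0 < hs)
    (hm : m * hs ≤ φs) (hM : φs ≤ M * hs)
    (H : ∀ a, ∃ c ht φt : ℝ, 0 ≤ c ∧ h' a = c * hs + ht ∧ φ' a = c * φs + φt ∧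
      m * ht ≤ φt ∧ φt ≤ M * ht ∧ ht ≤ 3 * (c * hs)) :
    ∃ m' M', Enclosed h' φ' m' M' ∧ M' - m' = 3 / 4 * (M - m) := by
  obtain ⟨θ, hθ⟩ : ∃ θ, φs = θ * hs := ⟨φs / hs, by field_simp⟩
  subst hθ
  have hmθ : m ≤ θ := le_of_mul_le_mul_right hm hpos
  have hθM : θ ≤ M := le_of_mul_le_mul_right hM hpos
  refine ⟨m + (θ - m) / 4, M - (M - θ) / 4, fun a => ?_, by ring⟩
  obtain ⟨c, ht, φt, hc, e1, e2, h1, h2, h3⟩ := H a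
  rw [e1, e2]
  constructor
  · nlinarith [mul_le_mul_of_nonneg_left h3 (sub_nonneg.2 hmθ)]
  · nlinarith [mul_le_mul_of_nonneg_left h3 (sub_nonneg.2 hθM)]

section Contraction

variable {i : ℕ → Fin 2} {φ : ℕ → Fin 3 → ℝ} {n : ℕ} {m M : ℝ}

theorem Enclosed.contract_of_le {k : ℕ} (he : Enclosed (blockLength i n) (φ n) m M)
    (H : ∀ a, m * (blockLength i k a - blockLength i n 1) ≤ φ k a - φ n 1 ∧
      φ k a - φ n 1 ≤ M * (blockLength i k a - blockLength i n 1) ∧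
      blockLength i k a ≤ 4 * blockLength i n 1) :
    ∃ m' M', Enclosed (blockLength i k) (φ k) m' M' ∧ M' - m' = 3 / 4 * (M - m) := by
  refine Enclosed.contract (zero_lt_one.trans_le (one_le_blockLength i n 1)) (he 1).1 (he 1).2
    fun a => ⟨1, _, _, zero_le_one, ?_, ?_, (H a).1, (H a).2.1, ?_⟩
  · ring
  · ring
  · linarith [(H a).2.2]

theorem Enclosed.contract_of_zero_one_one (hφ : Evolves i φ)
    (he : Enclosed (blockLength i n) (φ n) m M)
    (h0 : i n = 0) (h1 : i (n + 1) = 1) (h2 : i (n + 2) = 1) :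
    ∃ m' M', Enclosed (blockLength i (n + 3)) (φ (n + 3)) m' M' ∧
      M' - m' = 3 / 4 * (M - m) := by
  refine he.contract_of_le fun a => ?_
  have hl := evolves_blockLength i
  obtain ⟨b0, b2, -⟩ := blockLength_balanced i n
  have p1 := one_le_blockLength i n 1
  have e0 := he 0
  have e1 := he 1
  have e2 := he 2
  rw [hl.of_eq_one _ h2, hl.of_eq_one _ h1, hl.of_eq_zero _ h0,
    hφ.of_eq_one _ h2, hφ.of_eq_one _ h1, hφ.of_eq_zero _ h0]
  refine ⟨?_, ?_, ?_⟩ <;> fin_cases a <;> simp <;> linarith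

theorem Enclosed.contract_of_one_zero_zero (hφ : Evolves i φ)
    (he : Enclosed (blockLength i n) (φ n) m M)
    (h0 : i n = 1) (h1 : i (n + 1) = 0) (h2 : i (n + 2) = 0) :
    ∃ m' M', Enclosed (blockLength i (n + 3)) (φ (n + 3)) m' M' ∧
      M' - m' = 3 / 4 * (M - m) := by
  refine he.contract_of_le fun a => ?_
  have hl := evolves_blockLength i
  obtain ⟨b0, b2, -⟩ := blockLength_balanced i n
  have p1 := one_le_blockLength i n 1
  have e0 := he 0
  have e1 := he 1
  have e2 := he 2
  rw [hl.of_eq_zero _ h2, hl.of_eq_zero _ h1, hl.of_eq_one _ h0,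
    hφ.of_eq_zero _ h2, hφ.of_eq_zero _ h1, hφ.of_eq_one _ h0]
  refine ⟨?_, ?_, ?_⟩ <;> fin_cases a <;> simp <;> linarith

theorem Enclosed.contract_of_zero_one_zero_one (hφ : Evolves i φ)
    (he : Enclosed (blockLength i n) (φ n) m M)
    (h0 : i n = 0) (h1 : i (n + 1) = 1) (h2 : i (n + 2) = 0) (h3 : i (n + 3) = 1) :
    ∃ m' M', Enclosed (blockLength i (n + 4)) (φ (n + 4)) m' M' ∧
      M' - m' = 3 / 4 * (M - m) := by
  refine he.contract_of_le fun a => ?_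
  have hl := evolves_blockLength i
  obtain ⟨b0, b2, -⟩ := blockLength_balanced i n
  have p1 := one_le_blockLength i n 1
  have e0 := he 0
  have e1 := he 1
  have e2 := he 2
  rw [hl.of_eq_one _ h3, hl.of_eq_zero _ h2, hl.of_eq_one _ h1, hl.of_eq_zero _ h0,
    hφ.of_eq_one _ h3, hφ.of_eq_zero _ h2, hφ.of_eq_one _ h1, hφ.of_eq_zero _ h0]
  refine ⟨?_, ?_, ?_⟩ <;> fin_cases a <;> simp <;> linarith

theorem Enclosed.contract_of_one_zero_one_zero (hφ : Evolves i φ)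
    (he : Enclosed (blockLength i n) (φ n) m M)
    (h0 : i n = 1) (h1 : i (n + 1) = 0) (h2 : i (n + 2) = 1) (h3 : i (n + 3) = 0) :
    ∃ m' M', Enclosed (blockLength i (n + 4)) (φ (n + 4)) m' M' ∧
      M' - m' = 3 / 4 * (M - m) := by
  refine he.contract_of_le fun a => ?_
  have hl := evolves_blockLength i
  obtain ⟨b0, b2, -⟩ := blockLength_balanced i n
  have p1 := one_le_blockLength i n 1
  have e0 := he 0
  have e1 := he 1
  have e2 := he 2
  rw [hl.of_eq_zero _ h3, hl.of_eq_one _ h2, hl.of_eq_zero _ h1, hl.of_eq_one _ h0,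
    hφ.of_eq_zero _ h3, hφ.of_eq_one _ h2, hφ.of_eq_zero _ h1, hφ.of_eq_one _ h0]
  refine ⟨?_, ?_, ?_⟩ <;> fin_cases a <;> simp <;> linarith

theorem Enclosed.contract_of_change (hφ : Evolves i φ)
    (he : Enclosed (blockLength i n) (φ n) m M) (hne : i n ≠ i (n + 1)) :
    ∃ k m' M', n ≤ k ∧ Enclosed (blockLength i k) (φ k) m' M' ∧
      M' - m' = 3 / 4 * (M - m) := by
  have he' := he.mono (evolves_blockLength i) hφ (Nat.le_succ n)
  rcases eq_zero_or_eq_one (i n) with h0 | h0 <;>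
    rcases eq_zero_or_eq_one (i (n + 1)) with h1 | h1 <;>
    rcases eq_zero_or_eq_one (i (n + 2)) with h2 | h2 <;>
    rcases eq_zero_or_eq_one (i (n + 3)) with h3 | h3 <;>
    first
    | exact absurd (h0.trans h1.symm) hne
    | exact ⟨n + 3, (he.contract_of_zero_one_one hφ h0 h1 h2).imp
        fun _ => Exists.imp fun _ => And.intro (by omega)⟩
    | exact ⟨n + 3, (he.contract_of_one_zero_zero hφ h0 h1 h2).imp
        fun _ => Exists.imp fun _ => And.intro (by omega)⟩
    | exact ⟨n + 4, (he.contract_of_zero_one_zero_one hφ h0 h1 h2 h3).imp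
        fun _ => Exists.imp fun _ => And.intro (by omega)⟩
    | exact ⟨n + 4, (he.contract_of_one_zero_one_zero hφ h0 h1 h2 h3).imp
        fun _ => Exists.imp fun _ => And.intro (by omega)⟩
    | exact ⟨n + 4, (he'.contract_of_zero_one_one hφ h1 h2 h3).imp
        fun _ => Exists.imp fun _ => And.intro (by omega)⟩
    | exact ⟨n + 4, (he'.contract_of_one_zero_zero hφ h1 h2 h3).imp
        fun _ => Exists.imp fun _ => And.intro (by omega)⟩

theorem Evolves.of_const_zero {h : ℕ → Fin 3 → ℝ} (hh : Evolves i h) (hc : ∀ k ≥ n, i k = 0)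
    (j : ℕ) : h (n + 2 * j) = ![h n 0, j * h n 0 + h n 1, j * h n 0 + h n 2] := by
  induction j with
  | zero => funext a; fin_cases a <;> simp
  | succ j ih =>
    rw [show n + 2 * (j + 1) = n + 2 * j + 1 + 1 by ring, hh.of_eq_zero _ (hc _ (by omega)),
      hh.of_eq_zero _ (hc _ (by omega)), ih]
    funext a
    fin_cases a <;> simp <;> ring

theorem Evolves.of_const_one {h : ℕ → Fin 3 → ℝ} (hh : Evolves i h) (hc : ∀ k ≥ n, i k = 1)
    (j : ℕ) : h (n + 2 * j) = ![j * h n 2 + h n 0, j * h n 2 + h n 1, h n 2] := by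
  induction j with
  | zero => funext a; fin_cases a <;> simp
  | succ j ih =>
    rw [show n + 2 * (j + 1) = n + 2 * j + 1 + 1 by ring, hh.of_eq_one _ (hc _ (by omega)),
      hh.of_eq_one _ (hc _ (by omega)), ih]
    funext a
    fin_cases a <;> simp <;> ring

theorem Enclosed.contract_of_const (hφ : Evolves i φ)
    (he : Enclosed (blockLength i n) (φ n) m M) (hc : ∀ k ≥ n, i k = i n) :
    ∃ k m' M', n ≤ k ∧ Enclosed (blockLength i k) (φ k) m' M' ∧
      M' - m' = 3 / 4 * (M - m) := by
  obtain ⟨b0, b2, -⟩ := blockLength_balanced i n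
  have hl := evolves_blockLength i
  have p := one_le_blockLength i n
  obtain ⟨j, hj⟩ := exists_nat_ge (blockLength i n 1)
  have hj0 : (0 : ℝ) ≤ j := Nat.cast_nonneg j
  have q0 := mul_le_mul_of_nonneg_left (p 0) hj0
  have q2 := mul_le_mul_of_nonneg_left (p 2) hj0
  refine ⟨n + 2 * j, ?_⟩
  suffices ∃ m' M', Enclosed (blockLength i (n + 2 * j)) (φ (n + 2 * j)) m' M' ∧
      M' - m' = 3 / 4 * (M - m) from
    this.imp fun _ => Exists.imp fun _ => And.intro (by omega)
  rcases eq_zero_or_eq_one (i n) with h | h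
  · rw [h] at hc
    rw [hl.of_const_zero hc, hφ.of_const_zero hc]
    refine Enclosed.contract (zero_lt_one.trans_le (p 0)) (he 0).1 (he 0).2 fun a => ?_
    fin_cases a
    · exact ⟨1, 0, 0, by simp, by simp, by simp, by simp, by simp, by simp; linarith [p 0]⟩
    · exact ⟨j, _, _, hj0, rfl, rfl, (he 1).1, (he 1).2, by linarith [p 0]⟩
    · exact ⟨j, _, _, hj0, rfl, rfl, (he 2).1, (he 2).2, by linarith [p 0]⟩
  · rw [h] at hc
    rw [hl.of_const_one hc, hφ.of_const_one hc]
    refine Enclosed.contract (zero_lt_one.trans_le (p 2)) (he 2).1 (he 2).2 fun a => ?_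
    fin_cases a
    · exact ⟨j, _, _, hj0, rfl, rfl, (he 0).1, (he 0).2, by linarith [p 0]⟩
    · exact ⟨j, _, _, hj0, rfl, rfl, (he 1).1, (he 1).2, by linarith [p 0]⟩
    · exact ⟨1, 0, 0, by simp, by simp, by simp, by simp, by simp, by simp; linarith [p 2]⟩

theorem const_or_exists_change (i : ℕ → Fin 2) (n : ℕ) :
    (∀ k ≥ n, i k = i n) ∨ ∃ k ≥ n, i k ≠ i (k + 1) := by
  by_contra! h
  obtain ⟨⟨k, hk, hne⟩, h⟩ := h
  refine hne ?_
  induction k, hk using Nat.le_induction with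
  | base => rfl
  | succ k hk ih =>
    rw [← h k hk]
    by_contra hne'
    exact hne' (ih hne')

theorem Enclosed.exists_contract (hφ : Evolves i φ)
    (he : Enclosed (blockLength i n) (φ n) m M) :
    ∃ k m' M', n ≤ k ∧ Enclosed (blockLength i k) (φ k) m' M' ∧
      M' - m' = 3 / 4 * (M - m) := by
  rcases const_or_exists_change i n with hc | ⟨k, hk, hne⟩
  · exact he.contract_of_const hφ hc
  · obtain ⟨l, m', M', hl, h⟩ :=
      (he.mono (evolves_blockLength i) hφ hk).contract_of_change hφ hne
    exact ⟨l, m', M', hk.trans hl, h⟩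

theorem Enclosed.exists_small (hφ : Evolves i φ)
    (he : Enclosed (blockLength i 0) (φ 0) m M) (j : ℕ) :
    ∃ k m' M', Enclosed (blockLength i k) (φ k) m' M' ∧ M' - m' = (3 / 4) ^ j * (M - m) := by
  induction j with
  | zero => exact ⟨0, m, M, he, by simp⟩
  | succ j ih =>
    obtain ⟨k, m', M', h, e⟩ := ih
    obtain ⟨l, m'', M'', -, h', e'⟩ := h.exists_contract hφ
    exact ⟨l, m'', M'', h', by rw [e', e, pow_succ]; ring⟩

/-- All columns of the matrix products have asymptotically the same direction. -/
theorem Evolves.exists_limit_ratio (hφ : Evolves i φ)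
    (he : Enclosed (blockLength i 0) (φ 0) m M) :
    ∃ L, ∀ ε > 0, ∃ N, ∀ n ≥ N, ∀ a, |φ n a - L * blockLength i n a| ≤ ε * blockLength i n a := by
  have hl := evolves_blockLength i
  have cmp : ∀ {n n' : ℕ} {m M m' M' : ℝ}, Enclosed (blockLength i n) (φ n) m M →
      Enclosed (blockLength i n') (φ n') m' M' → m ≤ M' := by
    intro n n' m M m' M' h h'
    have h1 := (h.mono hl hφ (le_max_left n n') 0).1
    have h2 := (h'.mono hl hφ (le_max_right n n') 0).2
    exact le_of_mul_le_mul_right (h1.trans h2)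
      (zero_lt_one.trans_le (one_le_blockLength i _ 0))
  set A : Set ℝ := {x | ∃ n y, Enclosed (blockLength i n) (φ n) x y}
  refine ⟨sSup A, fun ε hε => ?_⟩
  have hlim : Tendsto (fun j : ℕ => (3 / 4 : ℝ) ^ j * (M - m)) atTop (nhds 0) := by
    simpa using (tendsto_pow_atTop_nhds_zero_of_lt_one (by norm_num)
      (by norm_num : (3 / 4 : ℝ) < 1)).mul_const (M - m)
  obtain ⟨j, hj⟩ := (hlim.eventually (gt_mem_nhds hε)).exists
  obtain ⟨k, m', M', h, e⟩ := he.exists_small hφ j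
  have h1 : m' ≤ sSup A := le_csSup ⟨M', fun x ⟨_, _, hx⟩ => cmp hx h⟩ ⟨k, M', h⟩
  have h2 : sSup A ≤ M' := csSup_le ⟨m', k, M', h⟩ fun x ⟨_, _, hx⟩ => cmp hx h
  refine ⟨k, fun n hn a => ?_⟩
  obtain ⟨h3, h4⟩ := h.mono hl hφ hn a
  have p := one_le_blockLength i n a
  rw [abs_le]
  constructor <;> nlinarith

end Contraction

theorem exists_frequency_vector (i : ℕ → Fin 2) :
    ∃ L ∈ simplex, ∀ ε > 0, ∃ N, ∀ n ≥ N, ∀ a b,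
      |((blockMap i n a).count b : ℝ) - L b * blockLength i n a| ≤ ε * blockLength i n a := by
  have he : ∀ b, Enclosed (blockLength i 0) (fun a => ((blockMap i 0 a).count b : ℝ)) 0 1 := by
    intro b a
    simp only [blockLength, zero_mul, one_mul]
    exact ⟨Nat.cast_nonneg _, Nat.cast_le.2 List.count_le_length⟩
  choose L hL using fun b => (evolves_count i b).exists_limit_ratio (he b)
  have key : ∀ ε > 0, ∃ N, ∀ n ≥ N, ∀ a b,
      |((blockMap i n a).count b : ℝ) - L b * blockLength i n a| ≤ ε * blockLength i n a := by
    intro ε hε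
    choose N hN using fun b => hL b ε hε
    refine ⟨N 0 + N 1 + N 2, fun n hn a b => hN b n (le_trans ?_ hn) a⟩
    fin_cases b <;> simp <;> omega
  refine ⟨L, ⟨fun b => ?_, ?_⟩, key⟩
  · refine le_of_forall_pos_le_add fun ε hε => ?_
    obtain ⟨N, hN⟩ := key ε hε
    have h := (abs_le.1 (hN N le_rfl 0 b)).2
    have p := one_le_blockLength i N 0
    have c : (0 : ℝ) ≤ (blockMap i N 0).count b := Nat.cast_nonneg _
    nlinarith
  · refine eq_of_abs_sub_le_all fun ε hε => ?_
    obtain ⟨N, hN⟩ := key (ε / 3) (by positivity)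
    have p := one_le_blockLength i N 0
    have e : blockLength i N 0 = ∑ b, ((blockMap i N 0).count b : ℝ) := by
      simpa [blockLength] using sum_map_eq_sum_count (fun _ => 1) (blockMap i N 0)
    rw [Fin.sum_univ_three] at e
    have h0 := abs_le.1 (hN N le_rfl 0 0)
    have h1 := abs_le.1 (hN N le_rfl 0 1)
    have h2 := abs_le.1 (hN N le_rfl 0 2)
    rw [abs_le]
    constructor <;> nlinarith

/-! ### Densities of quasi-additive functions on languages -/

theorem length_subApply_le {τ : Fin 3 → List (Fin 3)} {B : ℕ} (hB : ∀ a, (τ a).length ≤ B)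
    (v : List (Fin 3)) : (subApply τ v).length ≤ B * v.length := by
  induction v with
  | nil => simp [subApply]
  | cons a v ih =>
    have e : subApply τ (a :: v) = τ a ++ subApply τ v := by simp [subApply]
    rw [e, List.length_append, List.length_cons, mul_add_one]
    linarith [hB a]

theorem mul_length_le_length_subApply {τ : Fin 3 → List (Fin 3)} {B : ℝ}
    (hB : ∀ a, B ≤ (τ a).length) (v : List (Fin 3)) :
    B * v.length ≤ (subApply τ v).length := by
  induction v with
  | nil => simp [subApply]
  | cons a v ih =>
    have e : subApply τ (a :: v) = τ a ++ subApply τ v := by simp [subApply]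
    rw [e, List.length_append, List.length_cons]
    push_cast
    linarith [hB a]

theorem QuasiAdditive.exists_density_of_desubstitution {K : ℝ} {φ : List (Fin 3) → ℝ}
    (hφ : QuasiAdditive K φ) {S S' : Set (List (Fin 3))} {τ : Fin 3 → List (Fin 3)}
    {B B' : ℕ} (hτ : ∀ a, (τ a).length ≤ B')
    (hS : ∀ v ∈ S, ∃ s v' p, v' ∈ S' ∧ v = s ++ subApply τ v' ++ p ∧
      s.length ≤ B ∧ p.length ≤ B)
    {ρ ε : ℝ} {N' : ℕ} (hε : 0 < ε)
    (h : ∀ v ∈ S', N' ≤ v.length →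
      |φ (subApply τ v) - ρ * (subApply τ v).length| ≤ ε * (subApply τ v).length) :
    ∃ N : ℕ, ∀ v ∈ S, N ≤ v.length → |φ v - ρ * v.length| ≤ 2 * ε * v.length := by
  obtain ⟨C, hC0, hC⟩ := exists_bound_of_length_le φ B
  obtain ⟨n, hn⟩ := exists_nat_ge ((2 * K + 2 * C + |ρ| * (2 * B)) / ε)
  refine ⟨2 * B + B' * N' + 1 + n, fun v hv hvN => ?_⟩
  obtain ⟨s, v', p, hv', rfl, hs, hp⟩ := hS v hv
  set t := subApply τ v'
  have ht : t.length ≤ B' * v'.length := length_subApply_le hτ v'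
  simp only [List.length_append] at hvN ⊢
  have hN' : N' ≤ v'.length := by
    by_contra! hlt
    have := Nat.mul_le_mul_left B' hlt.le
    omega
  have h0 := h v' hv' hN'
  have hsum := hφ (s ++ t) p
  have hst := hφ s t
  have hs' := hC s hs
  have hp' := hC p hp
  have hsp : |ρ * ((s.length : ℝ) + p.length)| ≤ |ρ| * (2 * B) := by
    rw [abs_mul]
    refine mul_le_mul_of_nonneg_left ?_ (abs_nonneg _)
    rw [abs_of_nonneg (by positivity)]
    have h1 : (s.length : ℝ) ≤ B := Nat.cast_le.2 hs
    have h2 : (p.length : ℝ) ≤ B := Nat.cast_le.2 hp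
    linarith
  have hE : 2 * K + 2 * C + |ρ| * (2 * B) ≤ ε * (s.length + t.length + p.length) := by
    rw [div_le_iff₀ hε] at hn
    have : (n : ℝ) ≤ s.length + t.length + p.length := by exact_mod_cast (by omega)
    nlinarith
  have hlen : ε * t.length ≤ ε * (s.length + t.length + p.length) := by
    gcongr
    linarith [(Nat.cast_nonneg s.length : (0 : ℝ) ≤ _), (Nat.cast_nonneg p.length : (0 : ℝ) ≤ _)]
  push_cast
  rw [abs_le] at *
  constructor <;> linarith

theorem exists_letter_density {i : ℕ → Fin 2} {L : Fin 3 → ℝ}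
    (hL : ∀ ε > 0, ∃ N, ∀ n ≥ N, ∀ a b,
      |((blockMap i n a).count b : ℝ) - L b * blockLength i n a| ≤ ε * blockLength i n a)
    (b : Fin 3) {ε : ℝ} (hε : 0 < ε) :
    ∃ N : ℕ, ∀ v ∈ language i, N ≤ v.length →
      |(v.count b : ℝ) - L b * v.length| ≤ ε * v.length := by
  obtain ⟨n, hn⟩ := hL (ε / 2) (by positivity)
  have h := (quasiAdditive_count b).exists_density_of_desubstitution (length_blockMap_le i n)
    (S' := language fun k => i (n + k)) (ρ := L b) (N' := 0)
    (fun v hv => exists_desubstitution i n hv) (half_pos hε) fun v _ _ => ?_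
  · simpa [mul_div_cancel₀] using h
  · clear * - hn
    induction v with
    | nil => simp [subApply]
    | cons a v ih =>
      have e : subApply (blockMap i n) (a :: v) = blockMap i n a ++ subApply (blockMap i n) v := by
        simp [subApply]
      have h := hn n le_rfl a b
      unfold blockLength at h
      rw [e, List.count_append, List.length_append]
      push_cast
      rw [abs_le] at *
      constructor <;> linarith

theorem exists_le_blockLength {i : ℕ → Fin 2} (hi : ¬ ∃ n, ∀ k ≥ n, i k = i n) (j : ℕ) :
    ∃ n, ∀ a, (j : ℝ) ≤ blockLength i n a := by
  have hl := evolves_blockLength i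
  have mono : ∀ n, blockLength i n 1 ≤ blockLength i (n + 1) 1 := by
    intro n
    have b := (blockLength_balanced i n).2.2
    rcases eq_zero_or_eq_one (i n) with h | h
    · rw [hl.of_eq_zero n h]
      simpa
    · rw [hl.of_eq_one n h]
      simpa
  have grow : ∀ n, blockLength i n 1 + 1 ≤ blockLength i (n + 2) 1 := by
    intro n
    have p0 := one_le_blockLength i n 0
    have p2 := one_le_blockLength i n 2
    rcases eq_zero_or_eq_one (i n) with h | h <;>
      rcases eq_zero_or_eq_one (i (n + 1)) with h' | h' <;>
      simp [h, h', hl.of_eq_zero, hl.of_eq_one] <;> linarith [blockLength_balanced i n]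
  have large : ∀ j : ℕ, (j : ℝ) ≤ blockLength i (2 * j) 1 := by
    intro j
    induction j with
    | zero => simpa using zero_le_one.trans (one_le_blockLength i 0 1)
    | succ j ih =>
      push_cast
      exact (add_le_add_left ih 1).trans (grow (2 * j))
  push Not at hi
  obtain ⟨k, hk, hne⟩ := (const_or_exists_change i (2 * j)).resolve_left
    fun h => (hi (2 * j)).elim fun k hk => hk.2 (h k hk.1)
  have hjk : (j : ℝ) ≤ blockLength i k 1 := (large j).trans (monotone_nat_of_le_succ mono hk)
  obtain ⟨b0, b2, b1⟩ := blockLength_balanced i k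
  have p0 := one_le_blockLength i k 0
  have p2 := one_le_blockLength i k 2
  refine ⟨k + 2, fun a => ?_⟩
  rcases eq_zero_or_eq_one (i k) with h | h <;>
    rcases eq_zero_or_eq_one (i (k + 1)) with h' | h'
  · exact absurd (h.trans h'.symm) hne
  · rw [hl.of_eq_one _ h', hl.of_eq_zero _ h]
    fin_cases a <;> simp <;> linarith
  · rw [hl.of_eq_zero _ h', hl.of_eq_one _ h]
    fin_cases a <;> simp <;> linarith
  · exact absurd (h.trans h'.symm) hne

theorem QuasiAdditive.exists_density_of_growing {i : ℕ → Fin 2} {K : ℝ} {φ : List (Fin 3) → ℝ}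
    (hφ : QuasiAdditive K φ) (hi : ¬ ∃ n, ∀ k ≥ n, i k = i n) {ε : ℝ} (hε : 0 < ε) :
    ∃ (ρ : ℝ) (N : ℕ), ∀ v ∈ language i, N ≤ v.length → |φ v - ρ * v.length| ≤ ε * v.length := by
  have hK := hφ.nonneg
  obtain ⟨j, hj⟩ := exists_nat_ge ((2 * K + 1) / (ε / 2))
  rw [div_le_iff₀ (half_pos hε)] at hj
  obtain ⟨m, hm⟩ := exists_le_blockLength hi j
  obtain ⟨f, ⟨hf0, hf1⟩, hf⟩ := exists_frequency_vector fun k => i (m + k)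
  set τ := blockMap i m
  set α := ∑ a, f a * φ (τ a)
  set β := ∑ a, f a * ((τ a).length : ℝ)
  have hβ : 1 ≤ β := by
    have h1 := fun a => mul_le_mul_of_nonneg_left (one_le_blockLength i m a) (hf0 a)
    have h2 := add_le_add (add_le_add (h1 0) (h1 1)) (h1 2)
    simp only [β, Fin.sum_univ_three]
    simp only [mul_one, hf1] at h2
    exact h2
  have hρ : α / β * β = α := div_mul_cancel₀ _ (by positivity)
  set ρ := α / β
  set G := ∑ a, |φ (τ a) - ρ * (τ a).length|
  have hG : 0 ≤ G := Finset.sum_nonneg fun a _ => abs_nonneg _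
  choose N hN using fun b => exists_letter_density hf b
    (show 0 < 1 / (G + 1) by positivity)
  have key : ∀ v ∈ language (fun k => i (m + k)), N 0 + N 1 + N 2 + 1 ≤ v.length →
      |φ (subApply τ v) - ρ * (subApply τ v).length| ≤ ε / 2 * (subApply τ v).length := by
    intro v hv hvN
    have hv1 : (1 : ℝ) ≤ v.length := by exact_mod_cast (by omega : 1 ≤ v.length)
    have h1 : |φ (subApply τ v) - ∑ a, (v.count a : ℝ) * φ (τ a)| ≤ K * v.length + K := by
      rw [← sum_map_eq_sum_count]
      exact hφ.abs_subApply_sub_le τ v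
    have h2 : ((subApply τ v).length : ℝ) = ∑ a, (v.count a : ℝ) * (τ a).length := by
      rw [← sum_map_eq_sum_count]
      simp [subApply, List.length_flatMap, Function.comp_def]
    have h3 : ∑ a, (v.count a : ℝ) * φ (τ a) - ρ * (subApply τ v).length =
        ∑ a, ((v.count a : ℝ) - f a * v.length) * (φ (τ a) - ρ * (τ a).length) := by
      have : α - ρ * β = 0 := by rw [hρ, sub_self]
      rw [h2, ← sub_eq_zero]
      simp only [α, β, Fin.sum_univ_three] at this ⊢
      linear_combination (v.length : ℝ) * this
    have h4 : |∑ a, (v.count a : ℝ) * φ (τ a) - ρ * (subApply τ v).length| ≤ v.length := by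
      rw [h3]
      calc _ ≤ ∑ a, |((v.count a : ℝ) - f a * v.length) * (φ (τ a) - ρ * (τ a).length)| :=
            Finset.abs_sum_le_sum_abs _ _
        _ ≤ ∑ a, 1 / (G + 1) * v.length * |φ (τ a) - ρ * (τ a).length| := by
            refine Finset.sum_le_sum fun a _ => ?_
            rw [abs_mul]
            refine mul_le_mul_of_nonneg_right (hN a v hv (le_trans ?_ hvN)) (abs_nonneg _)
            fin_cases a <;> simp <;> omega
        _ = G / (G + 1) * v.length := by rw [← Finset.mul_sum]; ring
        _ ≤ 1 * v.length := by
            gcongr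
            rw [div_le_one (by positivity)]
            linarith
        _ = v.length := one_mul _
    have h5 := mul_length_le_length_subApply hm v
    rw [abs_le] at *
    constructor <;> nlinarith
  obtain ⟨N', hN'⟩ := hφ.exists_density_of_desubstitution (length_blockMap_le i m)
    (fun v hv => exists_desubstitution i m hv) (half_pos hε) key
  exact ⟨ρ, N', by simpa [mul_div_cancel₀] using hN'⟩

theorem language_const {i : ℕ → Fin 2} (hi : ∀ k, i k = i 0) :
    ∃ c, ∀ v ∈ language i, ∃ s l p, v = s ++ List.replicate l c ++ p ∧
      s.length ≤ 1 ∧ p.length ≤ 1 := by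
  have infix_replicate : ∀ {v : List (Fin 3)} {l : ℕ} {c : Fin 3}, v <:+: List.replicate l c →
      v = List.replicate v.length c := fun h =>
    List.eq_replicate_iff.2 ⟨rfl, fun b hb => List.eq_of_mem_replicate (h.subset hb)⟩
  rcases eq_zero_or_eq_one (i 0) with h | h
  · refine ⟨0, ?_⟩
    have key : ∀ n, blockMap i n 0 = [0] ∧
        ∀ a, ∃ l x, blockMap i n a = List.replicate l 0 ++ [x] := by
      intro n
      induction n with
      | zero => exact ⟨rfl, fun a => ⟨0, a, rfl⟩⟩
      | succ n ih =>
        obtain ⟨h0, hn⟩ := ih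
        rw [blockMap_succ_of_eq_zero ((hi n).trans h)]
        refine ⟨by simpa using h0, fun a => ?_⟩
        fin_cases a
        · exact hn 0
        · obtain ⟨l, x, e⟩ := hn 2
          exact ⟨l + 1, x, by simp [h0, e, List.replicate_succ]⟩
        · exact hn 1
    rintro v ⟨n, a, hv⟩
    obtain ⟨l, x, e⟩ := (key n).2 a
    rw [e, List.infix_concat_iff] at hv
    rcases hv with hv | hv
    · rw [List.suffix_concat_iff] at hv
      rcases hv with rfl | ⟨t, rfl, ht⟩
      · exact ⟨[], 0, [], by simp⟩
      · exact ⟨[], t.length, [x], by simpa using infix_replicate ht.isInfix, by simp⟩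
    · exact ⟨[], v.length, [], by simpa using infix_replicate hv, by simp⟩
  · refine ⟨2, ?_⟩
    have key : ∀ n, blockMap i n 2 = [2] ∧
        ∀ a, ∃ l x, blockMap i n a = x :: List.replicate l 2 := by
      intro n
      induction n with
      | zero => exact ⟨rfl, fun a => ⟨0, a, rfl⟩⟩
      | succ n ih =>
        obtain ⟨h0, hn⟩ := ih
        rw [blockMap_succ_of_eq_one ((hi n).trans h)]
        refine ⟨by simpa using h0, fun a => ?_⟩
        fin_cases a
        · exact hn 1
        · obtain ⟨l, x, e⟩ := hn 0
          exact ⟨l + 1, x, by simp [h0, e, List.replicate_succ']⟩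
        · exact hn 2
    rintro v ⟨n, a, hv⟩
    obtain ⟨l, x, e⟩ := (key n).2 a
    rw [e, List.infix_cons_iff] at hv
    rcases hv with hv | hv
    · rw [List.prefix_cons_iff] at hv
      rcases hv with rfl | ⟨t, rfl, ht⟩
      · exact ⟨[], 0, [], by simp⟩
      · exact ⟨[x], t.length, [], by simpa using infix_replicate ht.isInfix, by simp⟩
    · exact ⟨[], v.length, [], by simpa using infix_replicate hv, by simp⟩

/-- Densities along powers of a word, by Fekete's lemma. -/
theorem QuasiAdditive.exists_density_replicate {K : ℝ} {φ : List (Fin 3) → ℝ}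
    (hφ : QuasiAdditive K φ) (τ : Fin 3 → List (Fin 3)) (c : Fin 3) :
    ∃ α : ℝ, ∀ ε > 0, ∃ N : ℕ, ∀ l ≥ N,
      |φ (subApply τ (List.replicate l c)) - α * l| ≤ ε * l := by
  have hK := hφ.nonneg
  have hsub : Subadditive fun l => φ (subApply τ (List.replicate l c)) + K := by
    intro l l'
    have h := hφ (subApply τ (List.replicate l c)) (subApply τ (List.replicate l' c))
    rw [← subApply_append, List.replicate_append_replicate] at h
    linarith [(abs_le.1 h).2]
  have hbdd : BddBelow
      (Set.range fun l : ℕ => (φ (subApply τ (List.replicate l c)) + K) / l) := by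
    refine ⟨-(|φ (τ c)| + K), ?_⟩
    rintro _ ⟨l, rfl⟩
    have h := (abs_le.1 (hφ.abs_subApply_sub_le τ (List.replicate l c))).1
    simp only [List.map_replicate, List.sum_replicate, List.length_replicate, nsmul_eq_mul] at h
    rcases Nat.eq_zero_or_pos l with rfl | hl
    · simp only [CharP.cast_eq_zero, div_zero]
      linarith [abs_nonneg (φ (τ c))]
    · have hl' : (0 : ℝ) < l := Nat.cast_pos.2 hl
      simp only [le_div_iff₀ hl']
      nlinarith [neg_abs_le (φ (τ c))]
  refine ⟨hsub.lim, fun ε hε => ?_⟩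
  obtain ⟨N, hN⟩ := Metric.tendsto_atTop.1 (hsub.tendsto_lim hbdd) (ε / 2) (half_pos hε)
  obtain ⟨N', hN'⟩ := exists_nat_ge (K / (ε / 2))
  rw [div_le_iff₀ (half_pos hε)] at hN'
  refine ⟨N + N' + 1, fun l hl => ?_⟩
  have hl' : (0 : ℝ) < l := Nat.cast_pos.2 (by omega)
  have hlN : (N' : ℝ) ≤ l := Nat.cast_le.2 (by omega)
  have h := (hN l (by omega)).le
  rw [Real.dist_eq, abs_le, le_sub_iff_add_le, sub_le_iff_le_add, le_div_iff₀ hl',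
    div_le_iff₀ hl'] at h
  rw [abs_le]
  constructor <;> nlinarith

theorem QuasiAdditive.exists_density_of_const {i : ℕ → Fin 2} {K : ℝ} {φ : List (Fin 3) → ℝ}
    (hφ : QuasiAdditive K φ) {m : ℕ} (hi : ∀ k ≥ m, i k = i m) {ε : ℝ} (hε : 0 < ε) :
    ∃ (ρ : ℝ) (N : ℕ), ∀ v ∈ language i, N ≤ v.length → |φ v - ρ * v.length| ≤ ε * v.length := by
  obtain ⟨c, hc⟩ := language_const (i := fun k => i (m + k)) fun k => hi (m + k) (by omega)
  obtain ⟨α, hα⟩ := hφ.exists_density_replicate (blockMap i m) c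
  obtain ⟨N, hN⟩ := hα (ε / 2) (half_pos hε)
  have hlen : ∀ l : ℕ, ((subApply (blockMap i m) (List.replicate l c)).length : ℝ) =
      l * blockLength i m c := by
    intro l
    simp [subApply, List.length_flatMap, blockLength]
  have hp := one_le_blockLength i m c
  have h := hφ.exists_density_of_desubstitution (S := language i)
    (S' := Set.range fun l => List.replicate l c) (τ := blockMap i m) (B := 2 ^ m + 2 ^ m)
    (ρ := α / blockLength i m c) (N' := N) (length_blockMap_le i m) ?_ (half_pos hε) ?_
  · exact ⟨_, by simpa [mul_div_cancel₀] using h⟩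
  · intro v hv
    obtain ⟨s, v', p, hv', rfl, hs, hp⟩ := exists_desubstitution i m hv
    obtain ⟨s', l, p', rfl, hs', hp'⟩ := hc v' hv'
    refine ⟨s ++ subApply (blockMap i m) s', _, subApply (blockMap i m) p' ++ p, ⟨l, rfl⟩,
      by simp [subApply_append], ?_, ?_⟩ <;> rw [List.length_append]
    · have := length_subApply_le (length_blockMap_le i m) s'
      nlinarith [Nat.mul_le_mul_left (2 ^ m) hs']
    · have := length_subApply_le (length_blockMap_le i m) p'
      nlinarith [Nat.mul_le_mul_left (2 ^ m) hp']
  · rintro _ ⟨l, rfl⟩ hl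
    have h := hN l (by simpa using hl)
    rw [hlen, show α / blockLength i m c * (l * blockLength i m c) = α * l by field_simp]
    refine h.trans ?_
    have hl0 : (0 : ℝ) ≤ l := Nat.cast_nonneg l
    gcongr
    nlinarith

theorem QuasiAdditive.exists_density {i : ℕ → Fin 2} {K : ℝ} {φ : List (Fin 3) → ℝ}
    (hφ : QuasiAdditive K φ) {ε : ℝ} (hε : 0 < ε) :
    ∃ (ρ : ℝ) (N : ℕ), ∀ v ∈ language i, N ≤ v.length → |φ v - ρ * v.length| ≤ ε * v.length := by
  by_cases hi : ∃ n, ∀ k ≥ n, i k = i n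
  · obtain ⟨m, hm⟩ := hi
    exact hφ.exists_density_of_const hm hε
  · exact hφ.exists_density_of_growing hi hε

/-! ### Frequencies in C-adic words -/

theorem length_win (w : ℕ → Fin 3) (k n : ℕ) : (win w k n).length = n := by
  simp [win]

theorem win_mem_language {i : ℕ → Fin 2} {w : ℕ → Fin 3} {a : ℕ → Fin 3}
    (hw : LimitWord (fun n => cSub (i n)) a w) (k n : ℕ) : win w k n ∈ language i := by
  obtain ⟨N, hN⟩ := hw (k + n)
  obtain ⟨hlen, hget⟩ := hN N le_rfl
  refine ⟨N, a N, ?_⟩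
  have e : win w k n = ((blockMap i N (a N)).drop k).take n := by
    refine List.ext_getElem? fun j => ?_
    rcases lt_or_ge j n with hj | hj
    · rw [List.getElem?_take_of_lt hj, List.getElem?_drop, hget (k + j) (by omega)]
      simp [win, hj]
    · rw [List.getElem?_eq_none (by rwa [length_win]),
        List.getElem?_eq_none (by simp; omega)]
  rw [e]
  exact (List.take_prefix _ _).isInfix.trans (List.drop_suffix _ _).isInfix

theorem abs_div_sub_le {x ρ ε : ℝ} {n : ℕ} (hn : 0 < n) (h : |x - ρ * n| ≤ ε * n) :
    |x / n - ρ| ≤ ε := by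
  have hn' : (0 : ℝ) < n := Nat.cast_pos.2 hn
  rwa [div_sub' hn'.ne', abs_div, abs_of_pos hn', div_le_iff₀ hn', mul_comm (n : ℝ) ρ]

theorem exists_uniform_limit {q : ℕ → ℕ → ℝ}
    (h : ∀ ε > 0, ∃ (ρ : ℝ) (N : ℕ), ∀ n ≥ N, ∀ k, |q k n - ρ| ≤ ε) :
    ∃ L : ℝ, ∀ ε > 0, ∃ N : ℕ, ∀ n ≥ N, ∀ k, |q k n - L| < ε := by
  have hc : CauchySeq (q 0) := by
    refine Metric.cauchySeq_iff'.2 fun ε hε => ?_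
    obtain ⟨ρ, N, hN⟩ := h (ε / 3) (by positivity)
    refine ⟨N, fun n hn => ?_⟩
    have h1 := abs_le.1 (hN n hn 0)
    have h2 := abs_le.1 (hN N le_rfl 0)
    rw [Real.dist_eq, abs_lt]
    constructor <;> linarith
  obtain ⟨L, hL⟩ := cauchySeq_tendsto_of_complete hc
  refine ⟨L, fun ε hε => ?_⟩
  obtain ⟨ρ, N, hN⟩ := h (ε / 3) (by positivity)
  have hρ : |L - ρ| ≤ ε / 3 :=
    le_of_tendsto (hL.sub_const ρ).abs ((eventually_ge_atTop N).mono fun n hn => hN n hn 0)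
  refine ⟨N, fun n hn k => ?_⟩
  have h1 := abs_le.1 (hN n hn k)
  have h2 := abs_le.1 hρ
  rw [abs_lt]
  constructor <;> linarith

theorem pprod_apply (i : ℕ → Fin 2) (n : ℕ) (b a : Fin 3) :
    pprod (fun m => cMat (i m)) n b a = (blockMap i n a).count b := by
  induction n generalizing a with
  | zero => fin_cases a <;> fin_cases b <;> simp [pprod, blockMap, dirProd]
  | succ n ih =>
    have e : pprod (fun m => cMat (i m)) (n + 1) = pprod (fun m => cMat (i m)) n * cMat (i n) := by
      simp [pprod, List.range_succ]
    rw [e, Matrix.mul_apply, Fin.sum_univ_three, ih, ih, ih]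
    rcases eq_zero_or_eq_one (i n) with h | h
    · rw [blockMap_succ_of_eq_zero h, h]
      fin_cases a <;> simp [cMat, C1]
    · rw [blockMap_succ_of_eq_one h, h]
      fin_cases a <;> simp [cMat, C2]

theorem eq_of_mem_cone {i : ℕ → Fin 2} {L f : Fin 3 → ℝ}
    (hL : ∀ ε > 0, ∃ N, ∀ n ≥ N, ∀ a b,
      |((blockMap i n a).count b : ℝ) - L b * blockLength i n a| ≤ ε * blockLength i n a)
    (hf : f ∈ simplex) (hcone : ∀ n, f ∈ cone (pprod (fun m => cMat (i m)) n)) : f = L := by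
  funext b
  refine eq_of_abs_sub_le_all fun ε hε => ?_
  obtain ⟨N, hN⟩ := hL ε hε
  obtain ⟨x, hx0, hx⟩ := hcone N
  have hfx : ∀ b, f b = ∑ a, ((blockMap i N a).count b : ℝ) * x a := by
    intro b
    rw [hx]
    simp [Matrix.mulVec, dotProduct, pprod_apply]
  have hlen : ∀ a, blockLength i N a = ∑ b, ((blockMap i N a).count b : ℝ) := fun a => by
    simpa [blockLength] using sum_map_eq_sum_count (fun _ => 1) (blockMap i N a)
  have hsum : ∑ a, blockLength i N a * x a = 1 := by
    rw [← hf.2, hfx, hfx, hfx]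
    simp only [hlen, Fin.sum_univ_three]
    ring
  calc |f b - L b|
      = |∑ a, (((blockMap i N a).count b : ℝ) - L b * blockLength i N a) * x a| := by
        rw [hfx]
        nth_rw 1 [← mul_one (L b)]
        rw [← hsum, Finset.mul_sum, ← Finset.sum_sub_distrib]
        congr 1
        exact Finset.sum_congr rfl fun a _ => by ring
    _ ≤ ∑ a, |(((blockMap i N a).count b : ℝ) - L b * blockLength i N a) * x a| :=
        Finset.abs_sum_le_sum_abs _ _
    _ ≤ ∑ a, ε * (blockLength i N a * x a) := by
        refine Finset.sum_le_sum fun a _ => ?_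
        rw [abs_mul, abs_of_nonneg (hx0 a), ← mul_assoc]
        exact mul_le_mul_of_nonneg_right (hN N le_rfl a b) (hx0 a)
    _ = ε := by rw [← Finset.mul_sum, hsum, mul_one]

theorem Cadic_uniform_frequencies (i : ℕ → Fin 2) (w : ℕ → Fin 3)
    (hw : ∃ a : ℕ → Fin 3, LimitWord (fun n => cSub (i n)) a w) :
    (∀ u : List (Fin 3), (∃ k : ℕ, u = win w k u.length) →
      ∃ L : ℝ, ∀ ε > (0 : ℝ), ∃ N : ℕ, ∀ n ≥ N, ∀ k : ℕ,
        |(occ u (win w k n) : ℝ) / n - L| < ε) ∧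
    (∀ f ∈ simplex,
      (⋂ n : ℕ, cone (pprod (fun m => cMat (i m)) n)) = ray f →
      ∀ a : Fin 3, ∀ ε > (0 : ℝ), ∃ N : ℕ, ∀ n ≥ N, ∀ k : ℕ,
        |((win w k n).count a : ℝ) / n - f a| < ε) := by
  obtain ⟨a, ha⟩ := hw
  have hmem := win_mem_language ha
  refine ⟨fun u _ => exists_uniform_limit fun ε hε => ?_, fun f hf hcone b ε hε => ?_⟩
  · obtain ⟨ρ, N, hN⟩ := (quasiAdditive_occ u).exists_density (i := i) hε
    refine ⟨ρ, N + 1, fun n hn k => abs_div_sub_le (by omega) ?_⟩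
    have h := hN (win w k n) (hmem k n) (by rw [length_win]; omega)
    rwa [length_win] at h
  · obtain ⟨L, -, hL⟩ := exists_frequency_vector i
    have hfL : f = L := by
      refine eq_of_mem_cone hL hf fun n => ?_
      have hray : f ∈ ray f := ⟨1, zero_le_one, (one_smul ℝ f).symm⟩
      rw [← hcone] at hray
      exact Set.mem_iInter.1 hray n
    obtain ⟨N, hN⟩ := exists_letter_density hL b (half_pos hε)
    refine ⟨N + 1, fun n hn k => (abs_div_sub_le (by omega) ?_).trans_lt (half_lt_self hε)⟩
    have h := hN (win w k n) (hmem k n) (by rw [length_win]; omega)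
    rwa [length_win, ← hfL] at h
end
end

section
/- Let (M_n)_{n∈ℕ} ∈ {C1,C2}^ℕ and let f ∈ Δ be such that ⋂_{n≥0} M_{[0,n)} ℝ³_{≥0} = ℝ_{≥0} f. Then dim_ℚ(f) = 1 if and only if the sequence (M_n) is eventually constant, i.e., there exists N ∈ ℕ such that either M_n = C1 for all n ≥ N or M_n = C2 for all n ≥ N. -/
open Matrix Filter MeasureTheory

noncomputable section

/-- The dimension over `ℚ` of the vector space spanned by the entries of `f`. -/
def dimQ (f : Fin 3 → ℝ) : ℕ := Module.finrank ℚ (Submodule.span ℚ (Set.range f))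

lemma C1_mulVec (x : Fin 3 → ℝ) : C1.mulVec x = ![x 0 + x 1, x 2, x 1] := by
  ext i; fin_cases i <;> simp [C1, Matrix.mulVec, dotProduct, Fin.sum_univ_three]

lemma C2_mulVec (x : Fin 3 → ℝ) : C2.mulVec x = ![x 1, x 0, x 1 + x 2] := by
  ext i; fin_cases i <;> simp [C2, Matrix.mulVec, dotProduct, Fin.sum_univ_three]

lemma pprod_zero (M : ℕ → Matrix (Fin 3) (Fin 3) ℝ) : pprod M 0 = 1 := by
  simp [pprod]

lemma pprod_succ (M : ℕ → Matrix (Fin 3) (Fin 3) ℝ) (n : ℕ) :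
    pprod M (n + 1) = pprod M n * M n := by
  simp [pprod, List.range_succ]

lemma isUnit_pprod {M : ℕ → Matrix (Fin 3) (Fin 3) ℝ} (hM : ∀ n, M n = C1 ∨ M n = C2) (n : ℕ) :
    IsUnit (pprod M n) := by
  induction n with
  | zero => simp [pprod_zero]
  | succ n ih =>
    rw [pprod_succ]
    refine ih.mul ((Matrix.isUnit_iff_isUnit_det _).2 ?_)
    rcases hM n with h | h <;> rw [h] <;> simp [C1, C2, Matrix.det_fin_three]

/-- Products of `C1` and `C2` map integer vectors to integer vectors. -/
lemma exists_int_pprod_mulVec {M : ℕ → Matrix (Fin 3) (Fin 3) ℝ}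
    (hM : ∀ n, M n = C1 ∨ M n = C2) (n : ℕ) (k : Fin 3 → ℤ) :
    ∃ l : Fin 3 → ℤ, (pprod M n).mulVec (fun i => (k i : ℝ)) = fun i => (l i : ℝ) := by
  induction n generalizing k with
  | zero => exact ⟨k, by simp [pprod_zero]⟩
  | succ n ih =>
    rw [pprod_succ, ← Matrix.mulVec_mulVec]
    rcases hM n with h | h
    · obtain ⟨l, hl⟩ := ih ![k 0 + k 1, k 2, k 1]
      refine ⟨l, ?_⟩
      rw [← hl, h, C1_mulVec]
      congr 1; ext i; fin_cases i <;> simp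
    · obtain ⟨l, hl⟩ := ih ![k 1, k 0, k 1 + k 2]
      refine ⟨l, ?_⟩
      rw [← hl, h, C2_mulVec]
      congr 1; ext i; fin_cases i <;> simp

lemma cone_pprod_succ_subset {M : ℕ → Matrix (Fin 3) (Fin 3) ℝ}
    (hM : ∀ n, M n = C1 ∨ M n = C2) (n : ℕ) : cone (pprod M (n + 1)) ⊆ cone (pprod M n) := by
  rintro _ ⟨x, hx, rfl⟩
  refine ⟨(M n).mulVec x, fun i => ?_, by rw [pprod_succ, Matrix.mulVec_mulVec]⟩
  have h0 := hx 0
  have h1 := hx 1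
  have h2 := hx 2
  rcases hM n with h | h <;> rw [h]
  · rw [C1_mulVec]; fin_cases i <;> simp <;> linarith
  · rw [C2_mulVec]; fin_cases i <;> simp <;> linarith

/-- A nonnegative vector fixed by a tail of `M` yields a vector in every cone. -/
lemma pprod_mulVec_mem_iInter_cone {M : ℕ → Matrix (Fin 3) (Fin 3) ℝ}
    (hM : ∀ n, M n = C1 ∨ M n = C2) {N : ℕ} {v : Fin 3 → ℝ} (hv : ∀ i, 0 ≤ v i)
    (hfix : ∀ n ≥ N, (M n).mulVec v = v) :
    (pprod M N).mulVec v ∈ ⋂ n : ℕ, cone (pprod M n) := by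
  have hanti : Antitone fun n => cone (pprod M n) :=
    antitone_nat_of_succ_le (cone_pprod_succ_subset hM)
  refine Set.mem_iInter.2 fun n => ?_
  rcases le_total n N with h | h
  · exact hanti h ⟨v, hv, rfl⟩
  · refine ⟨v, hv, ?_⟩
    induction n, h using Nat.le_induction with
    | base => rfl
    | succ n hn ih => rw [pprod_succ, ← Matrix.mulVec_mulVec, hfix n hn, ih]

lemma simplex_ne_zero {f : Fin 3 → ℝ} (hf : f ∈ simplex) : f ≠ 0 := by
  rintro rfl
  simpa using hf.2

lemma dimQ_eq_one_of_smul_int {f : Fin 3 → ℝ} (hf : f ≠ 0) (c : ℝ) (l : Fin 3 → ℤ)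
    (h : ∀ i, f i = c * l i) : dimQ f = 1 := by
  have hle : Submodule.span ℚ (Set.range f) ≤ Submodule.span ℚ {c} := by
    rw [Submodule.span_le]
    rintro _ ⟨i, rfl⟩
    refine Submodule.mem_span_singleton.2 ⟨(l i : ℚ), ?_⟩
    rw [h, Rat.smul_def, mul_comm]
    simp
  apply le_antisymm
  · exact (Submodule.finrank_mono hle).trans (finrank_span_le_card _ |>.trans (by simp))
  · obtain ⟨i, hi⟩ := Function.ne_iff.1 hf
    have : FiniteDimensional ℚ (Submodule.span ℚ (Set.range f)) :=
      FiniteDimensional.span_of_finite ℚ (Set.finite_range f)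
    refine Submodule.one_le_finrank_iff.2 fun hbot => hi ?_
    simpa [hbot] using Submodule.subset_span (R := ℚ) (Set.mem_range_self (f := f) i)

lemma exists_smul_int_of_dimQ_eq_one {f : Fin 3 → ℝ} (hf : ∀ i, 0 ≤ f i) (h : dimQ f = 1) :
    ∃ c : ℝ, 0 < c ∧ ∃ k : Fin 3 → ℤ, ∀ i, f i = c * k i := by
  obtain ⟨⟨v, _⟩, hv0, hv⟩ := finrank_eq_one_iff'.1 h
  have hv0 : v ≠ 0 := fun h0 => hv0 (by simp [h0])
  have hr : ∀ i, ∃ r : ℚ, f i = r * v := fun i => by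
    obtain ⟨r, hr⟩ := hv ⟨f i, Submodule.subset_span (Set.mem_range_self i)⟩
    refine ⟨r, ?_⟩
    have := congrArg Subtype.val hr
    simpa [Rat.smul_def] using this.symm
  choose r hr using hr
  obtain ⟨b, hb⟩ := IsLocalization.exist_integer_multiples_of_finite (nonZeroDivisors ℤ) r
  choose k hk using hb
  have hb0 : ((b : ℤ) : ℝ) ≠ 0 := by exact_mod_cast nonZeroDivisors.ne_zero b.2
  refine ⟨|v| / |((b : ℤ) : ℝ)|, by positivity, fun i => |k i|, fun i => ?_⟩
  have hki : (k i : ℝ) = (b : ℤ) * r i := by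
    have := hk i
    simp only [zsmul_eq_mul, algebraMap_int_eq, eq_intCast] at this
    exact_mod_cast this
  rw [← abs_of_nonneg (hf i), hr, Int.cast_abs, hki, abs_mul, abs_mul]
  field_simp

/-- A coordinate sequence of nonnegative integer vectors under `C1` and `C2` forces the
sequence of matrices to be eventually constant. -/
lemma eventually_constant_of_orbit {M : ℕ → Matrix (Fin 3) (Fin 3) ℝ}
    (hM : ∀ n, M n = C1 ∨ M n = C2) {x : ℕ → Fin 3 → ℝ} (hx : ∀ n i, 0 ≤ x n i)
    (hx0 : ∀ n, x n ≠ 0) (hstep : ∀ n, x n = (M n).mulVec (x (n + 1)))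
    {c : ℝ} (hc : 0 < c) (hint : ∃ k : Fin 3 → ℤ, ∀ i, x 0 i = c * k i) :
    ∃ N : ℕ, (∀ n ≥ N, M n = C1) ∨ (∀ n ≥ N, M n = C2) := by
  have hcases : ∀ n,
      (M n = C1 ∧ x n 0 = x (n + 1) 0 + x (n + 1) 1 ∧ x n 1 = x (n + 1) 2 ∧
        x n 2 = x (n + 1) 1) ∨
      (M n = C2 ∧ x n 0 = x (n + 1) 1 ∧ x n 1 = x (n + 1) 0 ∧
        x n 2 = x (n + 1) 1 + x (n + 1) 2) := fun n => by
    have h := hstep n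
    rcases hM n with hn | hn
    · rw [hn, C1_mulVec] at h
      exact Or.inl ⟨hn, by rw [h]; rfl, by rw [h]; rfl, by rw [h]; rfl⟩
    · rw [hn, C2_mulVec] at h
      exact Or.inr ⟨hn, by rw [h]; rfl, by rw [h]; rfl, by rw [h]; rfl⟩
  have hk : ∀ n, ∃ k : Fin 3 → ℤ, ∀ i, x n i = c * k i := fun n => by
    induction n with
    | zero => exact hint
    | succ n ih =>
      obtain ⟨k, hk⟩ := ih
      have k0 := hk 0
      have k1 := hk 1
      have k2 := hk 2
      rcases hcases n with ⟨-, h0, h1, h2⟩ | ⟨-, h0, h1, h2⟩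
      · refine ⟨![k 0 - k 2, k 2, k 1], fun i => ?_⟩
        fin_cases i <;> simp <;> linarith
      · refine ⟨![k 1, k 0, k 2 - k 0], fun i => ?_⟩
        fin_cases i <;> simp <;> linarith
  choose k hk using hk
  have hsum : ∀ n, ∃ s : ℕ, x n 0 + x n 1 + x n 2 = c * s := fun n => by
    have hnn : 0 ≤ k n 0 + k n 1 + k n 2 := by
      have h : 0 ≤ c * ((k n 0 + k n 1 + k n 2 : ℤ) : ℝ) := by
        push_cast
        linarith [hx n 0, hx n 1, hx n 2, hk n 0, hk n 1, hk n 2]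
      exact_mod_cast nonneg_of_mul_nonneg_right h hc
    obtain ⟨s, hs⟩ := Int.eq_ofNat_of_zero_le hnn
    refine ⟨s, ?_⟩
    have hs' : (k n 0 + k n 1 + k n 2 : ℝ) = s := by exact_mod_cast hs
    rw [← hs']
    linarith [hk n 0, hk n 1, hk n 2]
  choose s hs using hsum
  have hdec : ∀ n, c * s n = c * s (n + 1) + x (n + 1) 1 := fun n => by
    rw [← hs, ← hs]
    rcases hcases n with ⟨-, h0, h1, h2⟩ | ⟨-, h0, h1, h2⟩ <;> linarith
  have hanti : Antitone s := antitone_nat_of_succ_le fun n => by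
    have h : c * (s (n + 1) : ℝ) ≤ c * s n := by linarith [hdec n, hx (n + 1) 1]
    exact_mod_cast le_of_mul_le_mul_left h hc
  obtain ⟨N, hN⟩ := WellFoundedLT.antitone_chain_condition hanti
  have hmid : ∀ n ≥ N, x (n + 1) 1 = 0 := fun n hn => by
    have h := hdec n
    rw [← hN n hn, ← hN (n + 1) (by omega)] at h
    linarith
  have hdich : ∀ n ≥ N + 1, (M n = C1 ∧ x n 2 = 0 ∧ x (n + 1) 2 = 0) ∨
      (M n = C2 ∧ x n 0 = 0 ∧ x (n + 1) 0 = 0) := fun n hn => by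
    have hm := hmid n (by omega)
    obtain ⟨m, rfl⟩ : ∃ m, n = m + 1 := ⟨n - 1, by omega⟩
    have hm' := hmid m (by omega)
    rcases hcases (m + 1) with ⟨h, h0, h1, h2⟩ | ⟨h, h0, h1, h2⟩
    · exact Or.inl ⟨h, by linarith, by linarith⟩
    · exact Or.inr ⟨h, by linarith, by linarith⟩
  have hnot : ∀ n ≥ N, ¬(x (n + 1) 0 = 0 ∧ x (n + 1) 2 = 0) := fun n hn h =>
    hx0 (n + 1) (by ext i; fin_cases i <;> simp [h.1, h.2, hmid n hn])
  refine ⟨N + 1, ?_⟩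
  rcases hM (N + 1) with h | h
  · left
    intro n hn
    induction n, hn using Nat.le_induction with
    | base => exact h
    | succ n hn ih =>
      rcases hdich (n + 1) (by omega) with h1 | ⟨h1, h2, -⟩
      · exact h1.1
      · rcases hdich n hn with ⟨-, -, h3⟩ | ⟨h3, -, h4⟩
        · exact (hnot n (by omega) ⟨h2, h3⟩).elim
        · exact h1.trans (h3.symm.trans ih)
  · right
    intro n hn
    induction n, hn using Nat.le_induction with
    | base => exact h
    | succ n hn ih =>
      rcases hdich (n + 1) (by omega) with ⟨h1, h2, -⟩ | h1
      · rcases hdich n hn with ⟨h3, -, h4⟩ | ⟨-, -, h3⟩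
        · exact h1.trans (h3.symm.trans ih)
        · exact (hnot n (by omega) ⟨h3, h2⟩).elim
      · exact h1.1

/-- If a tail of `M` fixes a nonzero nonnegative integer vector, the limit direction is rational. -/
lemma dimQ_eq_one_of_fixed {M : ℕ → Matrix (Fin 3) (Fin 3) ℝ}
    (hM : ∀ n, M n = C1 ∨ M n = C2) {f : Fin 3 → ℝ} (hf : f ∈ simplex)
    (hcone : (⋂ n : ℕ, cone (pprod M n)) = ray f) {N : ℕ} {k : Fin 3 → ℤ} (hk : ∀ i, 0 ≤ k i)
    (hk0 : k ≠ 0) (hfix : ∀ n ≥ N, (M n).mulVec (fun i => (k i : ℝ)) = fun i => (k i : ℝ)) :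
    dimQ f = 1 := by
  have hmem := pprod_mulVec_mem_iInter_cone hM (fun i => by exact_mod_cast hk i) hfix
  rw [hcone] at hmem
  obtain ⟨t, -, ht⟩ := hmem
  obtain ⟨l, hl⟩ := exists_int_pprod_mulVec hM N k
  have ht0 : t ≠ 0 := by
    rintro rfl
    have h0 : (fun i => (k i : ℝ)) = 0 :=
      Matrix.mulVec_injective_of_isUnit (isUnit_pprod hM N) (by simpa using ht)
    exact hk0 (funext fun i => by simpa using congrFun h0 i)
  refine dimQ_eq_one_of_smul_int (simplex_ne_zero hf) t⁻¹ l fun i => ?_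
  have := congrFun (hl.symm.trans ht) i
  simp only [Pi.smul_apply, smul_eq_mul] at this
  rw [this]
  field_simp

theorem dimQ_eq_one_iff_eventually_constant
    (M : ℕ → Matrix (Fin 3) (Fin 3) ℝ) (hM : ∀ n, M n = C1 ∨ M n = C2)
    (f : Fin 3 → ℝ) (hf : f ∈ simplex)
    (hcone : (⋂ n : ℕ, cone (pprod M n)) = ray f) :
    dimQ f = 1 ↔ ∃ N : ℕ, (∀ n ≥ N, M n = C1) ∨ (∀ n ≥ N, M n = C2) := by
  constructor
  · intro h
    have hmem : f ∈ ⋂ n : ℕ, cone (pprod M n) := hcone ▸ ⟨1, zero_le_one, (one_smul ℝ f).symm⟩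
    choose x hx hfx using Set.mem_iInter.1 hmem
    obtain ⟨c, hc, hint⟩ := exists_smul_int_of_dimQ_eq_one hf.1 h
    refine eventually_constant_of_orbit hM hx (fun n hn => simplex_ne_zero hf ?_) (fun n => ?_)
      hc ?_
    · rw [hfx n, hn, Matrix.mulVec_zero]
    · apply Matrix.mulVec_injective_of_isUnit (isUnit_pprod hM n)
      rw [Matrix.mulVec_mulVec, ← pprod_succ, ← hfx, ← hfx]
    · have h0 : f = x 0 := by simpa [pprod_zero] using hfx 0
      rwa [← h0]
  · rintro ⟨N, hN | hN⟩
    · refine dimQ_eq_one_of_fixed hM hf hcone (N := N) (k := ![1, 0, 0])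
        (fun i => by fin_cases i <;> simp) (by simp) fun n hn => ?_
      rw [hN n hn, C1_mulVec]
      ext i; fin_cases i <;> simp
    · refine dimQ_eq_one_of_fixed hM hf hcone (N := N) (k := ![0, 0, 1])
        (fun i => by fin_cases i <;> simp) (by simp) fun n hn => ?_
      rw [hN n hn, C2_mulVec]
      ext i; fin_cases i <;> simp
end
end

section
/- Let (M_n)_{n∈ℕ} ∈ {C1,C2}^ℕ and let f ∈ Δ be such that ⋂_{n≥0} M_{[0,n)} ℝ³_{≥0} = ℝ_{≥0} f. Then dim_ℚ(f) = 2 if and only if there exists N ∈ ℕ such that M_{N+2i} = M_{N+2i+1} for every i ∈ ℕ, but the sequence (M_n) is not eventually constant (i.e., there is no N' with M_n = M_{N'} for all n ≥ N'). -/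
open Matrix Filter MeasureTheory

noncomputable section

/-- The diameter of `{a, b, c, a + c}`, a Lyapunov function for the action of `C1` and `C2` on
integer row vectors. -/
def spread (a b c : ℤ) : ℤ := max (max a b) (max c (a + c)) - min (min a b) (min c (a + c))

/-- The triple has a positive and a negative entry. -/
def Mixed (a b c : ℤ) : Prop := (0 < a ∨ 0 < b ∨ 0 < c) ∧ (a < 0 ∨ b < 0 ∨ c < 0)

/-- The row vector `(a', b', c')` is the product of `(a, b, c)` with `C1` or `C2`. -/
def DualStep (a b c a' b' c' : ℤ) : Prop :=
  (a' = a ∧ b' = a + c ∧ c' = b) ∨ (a' = b ∧ b' = a + c ∧ c' = c)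

lemma spread_nonneg (a b c : ℤ) : 0 ≤ spread a b c := by
  unfold spread; omega

lemma spread_neg (a b c : ℤ) : spread (-a) (-b) (-c) = spread a b c := by
  unfold spread; omega

lemma spread_swap (a b c : ℤ) : spread c b a = spread a b c := by
  unfold spread; rw [add_comm c a]; omega

lemma Mixed.neg {a b c : ℤ} (h : Mixed a b c) : Mixed (-a) (-b) (-c) := by
  unfold Mixed at *; omega

lemma Mixed.swap {a b c : ℤ} (h : Mixed a b c) : Mixed c b a := by
  unfold Mixed at *; omega

lemma DualStep.neg {a b c a' b' c' : ℤ} (h : DualStep a b c a' b' c') :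
    DualStep (-a) (-b) (-c) (-a') (-b') (-c') := by
  unfold DualStep at *; omega

lemma DualStep.swap {a b c a' b' c' : ℤ} (h : DualStep a b c a' b' c') :
    DualStep c b a c' b' a' := by
  unfold DualStep at *; omega

lemma DualStep.spread_le {a b c a' b' c' : ℤ} (hs : DualStep a b c a' b' c')
    (h : Mixed a b c) (h' : Mixed a' b' c') : spread a' b' c' ≤ spread a b c := by
  unfold Mixed spread at *
  rcases hs with ⟨rfl, rfl, rfl⟩ | ⟨rfl, rfl, rfl⟩ <;> omega

lemma spread_of_pos {a b c : ℤ} (ha : 0 < a) (hc : 0 < c) (hb : b < 0) :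
    spread a b c = a - b + c := by
  unfold spread; omega

lemma spread_lt_or_of_pos {a₀ b₀ c₀ a₁ b₁ c₁ a₂ b₂ c₂ a₃ b₃ c₃ : ℤ} (ha : 0 < a₀) (hc : 0 < c₀)
    (h₀ : Mixed a₀ b₀ c₀) (h₂ : Mixed a₂ b₂ c₂) (h₃ : Mixed a₃ b₃ c₃)
    (hs₀ : DualStep a₀ b₀ c₀ a₁ b₁ c₁) (hs₁ : DualStep a₁ b₁ c₁ a₂ b₂ c₂)
    (hs₂ : DualStep a₂ b₂ c₂ a₃ b₃ c₃) :
    spread a₃ b₃ c₃ < spread a₀ b₀ c₀ ∨ (0 < a₂ ∧ 0 < c₂ ∧ b₀ < b₂ ∧ b₂ < 0) := by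
  have hb : b₀ < 0 := by unfold Mixed at h₀; omega
  rw [spread_of_pos ha hc hb]
  unfold Mixed at h₂ h₃
  clear h₀
  rcases hs₀ with ⟨rfl, rfl, rfl⟩ | ⟨rfl, rfl, rfl⟩ <;>
    rcases hs₁ with ⟨rfl, rfl, rfl⟩ | ⟨rfl, rfl, rfl⟩
  · omega
  · clear h₂
    unfold spread
    rcases hs₂ with ⟨rfl, rfl, rfl⟩ | ⟨rfl, rfl, rfl⟩ <;> omega
  · clear h₂
    unfold spread
    rcases hs₂ with ⟨rfl, rfl, rfl⟩ | ⟨rfl, rfl, rfl⟩ <;> omega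
  · omega

/-- The outer entries are nonzero of the same sign. -/
def SameSign (a c : ℤ) : Prop := (0 < a ∧ 0 < c) ∨ (a < 0 ∧ c < 0)

/-- The outer entries are nonzero of opposite signs. -/
def OppSign (a c : ℤ) : Prop := (0 < a ∧ c < 0) ∨ (a < 0 ∧ 0 < c)

lemma SameSign.spread_lt_or {a₀ b₀ c₀ a₁ b₁ c₁ a₂ b₂ c₂ a₃ b₃ c₃ : ℤ} (hac : SameSign a₀ c₀)
    (h₀ : Mixed a₀ b₀ c₀) (h₂ : Mixed a₂ b₂ c₂) (h₃ : Mixed a₃ b₃ c₃)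
    (hs₀ : DualStep a₀ b₀ c₀ a₁ b₁ c₁) (hs₁ : DualStep a₁ b₁ c₁ a₂ b₂ c₂)
    (hs₂ : DualStep a₂ b₂ c₂ a₃ b₃ c₃) :
    spread a₃ b₃ c₃ < spread a₀ b₀ c₀ ∨ (SameSign a₂ c₂ ∧ b₂.natAbs < b₀.natAbs) := by
  unfold SameSign at *
  rcases hac with ⟨ha, hc⟩ | ⟨ha, hc⟩
  · have := spread_lt_or_of_pos ha hc h₀ h₂ h₃ hs₀ hs₁ hs₂
    omega
  · have := spread_lt_or_of_pos (neg_pos.2 ha) (neg_pos.2 hc) h₀.neg h₂.neg h₃.neg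
      hs₀.neg hs₁.neg hs₂.neg
    rw [spread_neg, spread_neg] at this
    omega

lemma OppSign.spread_lt {a₀ b₀ c₀ a₁ b₁ c₁ a₂ b₂ c₂ : ℤ} (h₀ : OppSign a₀ c₀)
    (h₁ : OppSign a₁ c₁) (h₂ : OppSign a₂ c₂)
    (hs₀ : DualStep a₀ b₀ c₀ a₁ b₁ c₁) (hs₁ : DualStep a₁ b₁ c₁ a₂ b₂ c₂) :
    spread a₂ b₂ c₂ < spread a₀ b₀ c₀ := by
  unfold spread OppSign at *
  rcases hs₀ with ⟨rfl, rfl, rfl⟩ | ⟨rfl, rfl, rfl⟩ <;>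
    rcases hs₁ with ⟨rfl, rfl, rfl⟩ | ⟨rfl, rfl, rfl⟩ <;> omega

lemma spread_lt_of_zero_left {b c a₂ b₂ c₂ a₃ b₃ c₃ : ℤ}
    (h₀ : Mixed 0 b c) (h₂ : ¬SameSign a₂ c₂) (h₃ : Mixed a₃ b₃ c₃)
    (hs₁ : DualStep b c c a₂ b₂ c₂) (hs₂ : DualStep a₂ b₂ c₂ a₃ b₃ c₃) :
    spread a₃ b₃ c₃ < spread 0 b c := by
  unfold Mixed spread SameSign at *
  rcases hs₁ with ⟨rfl, rfl, rfl⟩ | ⟨rfl, rfl, rfl⟩ <;>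
    rcases hs₂ with ⟨rfl, rfl, rfl⟩ | ⟨rfl, rfl, rfl⟩ <;> omega

/-- The orbit of an integer row vector under right multiplication by `C1` (when `u n`) or `C2`. -/
structure DualOrbit (u : ℕ → Prop) (a b c : ℕ → ℤ) : Prop where
  left : ∀ n, u n → a (n + 1) = a n ∧ b (n + 1) = a n + c n ∧ c (n + 1) = b n
  right : ∀ n, ¬u n → a (n + 1) = b n ∧ b (n + 1) = a n + c n ∧ c (n + 1) = c n

namespace DualOrbit

variable {u : ℕ → Prop} {a b c : ℕ → ℤ}

lemma step (h : DualOrbit u a b c) (n : ℕ) :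
    DualStep (a n) (b n) (c n) (a (n + 1)) (b (n + 1)) (c (n + 1)) := by
  by_cases hu : u n
  · exact Or.inl (h.left n hu)
  · exact Or.inr (h.right n hu)

lemma swap (h : DualOrbit u a b c) : DualOrbit (fun n => ¬u n) c b a where
  left n hn := by have := h.right n hn; omega
  right n hn := by have := h.left n (not_not.1 hn); omega

lemma forall_left_of_zero (h : DualOrbit u a b c) (hm : ∀ n, Mixed (a n) (b n) (c n)) {N : ℕ}
    (hS : ∀ n ≥ N, ¬SameSign (a n) (c n))
    (hV : ∀ n ≥ N, ∀ k, spread (a n) (b n) (c n) ≤ spread (a k) (b k) (c k))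
    (hN : a N = 0) : ∀ n ≥ N, u n := by
  have key : ∀ n ≥ N, a n = 0 → u n := by
    intro n hn h0
    by_contra hu
    obtain ⟨h1, h2, h3⟩ := h.right n hu
    rw [h0, zero_add] at h2
    have hs := h.step (n + 1)
    have hm0 := hm n
    have hVn := hV n hn (n + 1 + 1 + 1)
    rw [h1, h2, h3] at hs
    rw [h0] at hm0 hVn
    exact absurd (spread_lt_of_zero_left hm0 (hS _ (by omega)) (hm _) hs (h.step (n + 1 + 1)))
      (not_lt.2 hVn)
  have zero : ∀ n ≥ N, a n = 0 := by
    intro n hn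
    induction n, hn using Nat.le_induction with
    | base => exact hN
    | succ n hn ih => rw [(h.left n (key n hn ih)).1, ih]
  exact fun n hn => key n hn (zero n hn)

/-- If all the vectors of a dual orbit have mixed signs, then the directive sequence is eventually
constant. -/
theorem eventually_const (h : DualOrbit u a b c) (hm : ∀ n, Mixed (a n) (b n) (c n)) :
    ∃ N, (∀ n ≥ N, u n) ∨ ∀ n ≥ N, ¬u n := by
  set V : ℕ → ℤ := fun n => spread (a n) (b n) (c n) with hVdef
  have hanti : Antitone V := antitone_nat_of_succ_le fun n =>
    (h.step n).spread_le (hm n) (hm (n + 1))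
  obtain ⟨N, hNmin⟩ : ∃ N, ∀ k, V N ≤ V k := by
    refine ⟨Function.argmin fun n => (V n).toNat, fun k => ?_⟩
    have h1 := Function.argmin_le (fun n => (V n).toNat) k
    have h2 : ∀ n, 0 ≤ V n := fun n => spread_nonneg _ _ _
    have h3 := h2 k
    have h4 := h2 (Function.argmin fun n => (V n).toNat)
    omega
  have hV : ∀ n ≥ N, ∀ k, V n ≤ V k := fun n hn k => (hanti hn).trans (hNmin k)
  have hS' : ∀ m n, n ≥ N → (b n).natAbs = m → ¬SameSign (a n) (c n) := by
    intro m
    induction m using Nat.strong_induction_on with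
    | _ m ih =>
      intro n hn hb hac
      rcases hac.spread_lt_or (hm n) (hm _) (hm _) (h.step n) (h.step (n + 1))
        (h.step (n + 1 + 1)) with hlt | ⟨hac', hb'⟩
      · exact absurd hlt (not_lt.2 (hV n hn _))
      · exact ih _ (hb ▸ hb') (n + 1 + 1) (by omega) rfl hac'
  have hS : ∀ n ≥ N, ¬SameSign (a n) (c n) := fun n hn => hS' _ n hn rfl
  obtain ⟨K, hK, hz⟩ : ∃ K ≥ N, ¬OppSign (a K) (c K) := by
    by_contra! hO
    exact absurd ((hO N le_rfl).spread_lt (hO (N + 1) (by omega)) (hO (N + 1 + 1) (by omega))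
      (h.step N) (h.step (N + 1))) (not_lt.2 (hV N le_rfl _))
  have hz' : a K = 0 ∨ c K = 0 := by
    have := hS K hK
    unfold SameSign at this
    unfold OppSign at hz
    omega
  refine ⟨K, ?_⟩
  rcases hz' with h0 | h0
  · exact Or.inl (h.forall_left_of_zero hm (fun n hn => hS n (hK.trans hn))
      (fun n hn => hV n (hK.trans hn)) h0)
  · refine Or.inr (h.swap.forall_left_of_zero (fun n => (hm n).swap) (fun n hn hac => ?_)
      (fun n hn k => ?_) h0)
    · exact hS n (hK.trans hn) (by unfold SameSign at *; omega)
    · rw [spread_swap (a n), spread_swap (a k)]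
      exact hV n (hK.trans hn) k

/-- A dual orbit of a nonzero vector never vanishes. -/
lemma ne_zero (h : DualOrbit u a b c) (h0 : ¬(a 0 = 0 ∧ b 0 = 0 ∧ c 0 = 0)) (n : ℕ) :
    ¬(a n = 0 ∧ b n = 0 ∧ c n = 0) := by
  induction n with
  | zero => exact h0
  | succ n ih =>
    have := h.step n
    unfold DualStep at this
    omega

lemma exists_of_init (u : ℕ → Prop) (l : Fin 3 → ℤ) :
    ∃ a b c : ℕ → ℤ, DualOrbit u a b c ∧ a 0 = l 0 ∧ b 0 = l 1 ∧ c 0 = l 2 := by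
  classical
  let s : ℕ → ℤ × ℤ × ℤ := fun n => Nat.rec (l 0, l 1, l 2) (fun n p =>
    if u n then (p.1, p.1 + p.2.2, p.2.1) else (p.2.1, p.1 + p.2.2, p.2.2)) n
  have hs : ∀ n, s (n + 1) = if u n then ((s n).1, (s n).1 + (s n).2.2, (s n).2.1)
      else ((s n).2.1, (s n).1 + (s n).2.2, (s n).2.2) := fun n => rfl
  refine ⟨fun n => (s n).1, fun n => (s n).2.1, fun n => (s n).2.2, ⟨fun n hn => ?_, fun n hn => ?_⟩,
    rfl, rfl, rfl⟩
  · simp [hs, hn]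
  · simp [hs, hn]

end DualOrbit

/-- A nonnegative backward orbit under `C1` (when `u n`) and `C2`. -/
structure Orbit (u : ℕ → Prop) (x : ℕ → Fin 3 → ℝ) : Prop where
  nonneg : ∀ n i, 0 ≤ x n i
  left : ∀ n, u n →
    x n 0 = x (n + 1) 0 + x (n + 1) 1 ∧ x n 1 = x (n + 1) 2 ∧ x n 2 = x (n + 1) 1
  right : ∀ n, ¬u n →
    x n 0 = x (n + 1) 1 ∧ x n 1 = x (n + 1) 0 ∧ x n 2 = x (n + 1) 1 + x (n + 1) 2

lemma dimQ_le_one {f : Fin 3 → ℝ} (k : Fin 3) (h : ∀ i, i ≠ k → f i = 0) : dimQ f ≤ 1 := by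
  have hle : Submodule.span ℚ (Set.range f) ≤ Submodule.span ℚ {f k} := by
    rw [Submodule.span_le]
    rintro _ ⟨i, rfl⟩
    by_cases hi : i = k
    · subst hi
      exact Submodule.subset_span rfl
    · rw [h i hi]
      exact Submodule.zero_mem _
  exact (Submodule.finrank_mono hle).trans (by simpa using finrank_span_le_card (R := ℚ) {f k})

lemma dimQ_eq_two {f : Fin 3 → ℝ} (h1 : f 1 = 0)
    (h : ∀ p q : ℤ, p * f 0 + q * f 2 = 0 → p = 0 ∧ q = 0) : dimQ f = 2 := by
  have hli : LinearIndependent ℚ ![f 0, f 2] := by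
    rw [← LinearIndependent.iff_fractionRing (R := ℤ) (K := ℚ), LinearIndependent.pair_iff]
    intro p q hpq
    exact h p q (by simpa using hpq)
  have hspan : Submodule.span ℚ (Set.range f) = Submodule.span ℚ (Set.range ![f 0, f 2]) := by
    refine le_antisymm (Submodule.span_le.2 ?_) (Submodule.span_mono ?_)
    · rintro _ ⟨i, rfl⟩
      fin_cases i
      · exact Submodule.subset_span ⟨0, rfl⟩
      · simp [h1]
      · exact Submodule.subset_span ⟨1, rfl⟩
    · rintro _ ⟨i, rfl⟩
      fin_cases i
      · exact ⟨0, rfl⟩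
      · exact ⟨2, rfl⟩
  rw [dimQ, hspan, finrank_span_eq_card hli, Fintype.card_fin]

lemma exists_int_relation {f : Fin 3 → ℝ} (h : dimQ f ≠ 3) :
    ∃ l : Fin 3 → ℤ, l ≠ 0 ∧ l 0 * f 0 + l 1 * f 1 + l 2 * f 2 = 0 := by
  have hli : ¬LinearIndependent ℤ f := by
    rw [LinearIndependent.iff_fractionRing (R := ℤ) (K := ℚ)]
    intro hli
    exact h (by rw [dimQ, finrank_span_eq_card hli, Fintype.card_fin])
  obtain ⟨l, hl, i, hi⟩ := Fintype.not_linearIndependent_iff.1 hli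
  refine ⟨l, fun h0 => hi (by simp [h0]), ?_⟩
  simpa [Fin.sum_univ_three] using hl

namespace Orbit

variable {u : ℕ → Prop} {x : ℕ → Fin 3 → ℝ}

lemma swap (h : Orbit u x) : Orbit (fun n => ¬u n) (fun n => ![x n 2, x n 1, x n 0]) where
  nonneg n i := by fin_cases i <;> exact h.nonneg n _
  left n hn := by
    obtain ⟨h0, h1, h2⟩ := h.right n hn
    refine ⟨?_, h1, h0⟩
    simpa [add_comm] using h2
  right n hn := by
    obtain ⟨h0, h1, h2⟩ := h.left n (not_not.1 hn)
    refine ⟨h2, h1, ?_⟩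
    simpa [add_comm] using h0

lemma span_succ (h : Orbit u x) (n : ℕ) :
    Submodule.span ℚ (Set.range (x (n + 1))) = Submodule.span ℚ (Set.range (x n)) := by
  have mem : ∀ m i, x m i ∈ Submodule.span ℚ (Set.range (x m)) :=
    fun m i => Submodule.subset_span ⟨i, rfl⟩
  by_cases hu : u n
  · obtain ⟨h0, h1, h2⟩ := h.left n hu
    refine le_antisymm (Submodule.span_le.2 ?_) (Submodule.span_le.2 ?_)
    · rintro _ ⟨i, rfl⟩
      fin_cases i
      · have := sub_mem (mem n 0) (mem n 2)
        rwa [h0, h2, add_sub_cancel_right] at this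
      · exact h2 ▸ mem n 2
      · exact h1 ▸ mem n 1
    · rintro _ ⟨i, rfl⟩
      fin_cases i
      · exact h0 ▸ add_mem (mem (n + 1) 0) (mem (n + 1) 1)
      · exact h1 ▸ mem (n + 1) 2
      · exact h2 ▸ mem (n + 1) 1
  · obtain ⟨h0, h1, h2⟩ := h.right n hu
    refine le_antisymm (Submodule.span_le.2 ?_) (Submodule.span_le.2 ?_)
    · rintro _ ⟨i, rfl⟩
      fin_cases i
      · exact h1 ▸ mem n 1
      · exact h0 ▸ mem n 0
      · have := sub_mem (mem n 2) (mem n 0)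
        rwa [h0, h2, add_sub_cancel_left] at this
    · rintro _ ⟨i, rfl⟩
      fin_cases i
      · exact h0 ▸ mem (n + 1) 1
      · exact h1 ▸ mem (n + 1) 0
      · exact h2 ▸ add_mem (mem (n + 1) 1) (mem (n + 1) 2)

lemma dimQ_eq (h : Orbit u x) (n : ℕ) : dimQ (x n) = dimQ (x 0) := by
  induction n with
  | zero => rfl
  | succ n ih => rw [← ih, dimQ, dimQ, h.span_succ]

lemma ne_zero (h : Orbit u x) (h0 : x 0 ≠ 0) (n : ℕ) : x n ≠ 0 := by
  induction n with
  | zero => exact h0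
  | succ n ih =>
    intro hn
    apply ih
    by_cases hu : u n
    · obtain ⟨h0, h1, h2⟩ := h.left n hu
      ext i
      fin_cases i <;> simp [h0, h1, h2, hn]
    · obtain ⟨h0, h1, h2⟩ := h.right n hu
      ext i
      fin_cases i <;> simp [h0, h1, h2, hn]

lemma eq_zero_of_forall_left (h : Orbit u x) {N : ℕ} (hu : ∀ n ≥ N, u n) :
    x N 1 = 0 ∧ x N 2 = 0 := by
  have key : ∀ k : ℕ, x (N + k) 1 + x (N + k) 2 = x N 1 + x N 2 ∧
      x (N + 2 * k) 0 + k * (x N 1 + x N 2) = x N 0 := by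
    have hsum : ∀ k : ℕ, x (N + k) 1 + x (N + k) 2 = x N 1 + x N 2 := by
      intro k
      induction k with
      | zero => simp
      | succ k ih =>
        have := h.left (N + k) (hu _ (by omega))
        rw [← add_assoc]
        linarith
    refine fun k => ⟨hsum k, ?_⟩
    induction k with
    | zero => simp
    | succ k ih =>
      have h1 := h.left (N + 2 * k) (hu _ (by omega))
      have h2 := h.left (N + 2 * k + 1) (hu _ (by omega))
      have h3 := hsum (2 * k)
      rw [show N + 2 * (k + 1) = N + 2 * k + 1 + 1 by ring]
      push_cast
      linarith
  have h1 := h.nonneg N 1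
  have h2 := h.nonneg N 2
  have hs : x N 1 + x N 2 = 0 := by
    by_contra hne
    have hpos : 0 < x N 1 + x N 2 := lt_of_le_of_ne (by positivity) (Ne.symm hne)
    obtain ⟨k, hk⟩ := exists_lt_nsmul hpos (x N 0)
    rw [nsmul_eq_mul] at hk
    have := (key k).2
    have := h.nonneg (N + 2 * k) 0
    linarith
  constructor <;> linarith

lemma dimQ_le_one_of_eventually_const (h : Orbit u x) {N : ℕ}
    (hu : (∀ n ≥ N, u n) ∨ ∀ n ≥ N, ¬u n) : dimQ (x 0) ≤ 1 := by
  rw [← h.dimQ_eq N]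
  rcases hu with hu | hu
  · obtain ⟨h1, h2⟩ := h.eq_zero_of_forall_left hu
    refine dimQ_le_one 0 fun i hi => ?_
    fin_cases i <;> simp_all
  · obtain ⟨h1, h2⟩ := h.swap.eq_zero_of_forall_left hu
    refine dimQ_le_one 2 fun i hi => ?_
    fin_cases i <;> simp_all

lemma exists_eq_zero (h : Orbit u x) (hu : ¬∃ N, (∀ n ≥ N, u n) ∨ ∀ n ≥ N, ¬u n)
    (hd : dimQ (x 0) ≠ 3) : ∃ n i, x n i = 0 := by
  obtain ⟨l, hl, hrel⟩ := exists_int_relation hd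
  obtain ⟨a, b, c, hD, ha, hb, hc⟩ := DualOrbit.exists_of_init u l
  have hdot : ∀ n, (a n : ℝ) * x n 0 + b n * x n 1 + c n * x n 2 = 0 := by
    intro n
    induction n with
    | zero => rw [ha, hb, hc]; exact hrel
    | succ n ih =>
      by_cases hn : u n
      · obtain ⟨h0, h1, h2⟩ := h.left n hn
        obtain ⟨e0, e1, e2⟩ := hD.left n hn
        rw [e0, e1, e2]
        rw [h0, h1, h2] at ih
        push_cast
        linarith
      · obtain ⟨h0, h1, h2⟩ := h.right n hn
        obtain ⟨e0, e1, e2⟩ := hD.right n hn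
        rw [e0, e1, e2]
        rw [h0, h1, h2] at ih
        push_cast
        linarith
  have hne := hD.ne_zero (fun h0 => hl (by
    ext i; fin_cases i <;> simp <;> omega))
  obtain ⟨n, hn⟩ : ∃ n, ¬Mixed (a n) (b n) (c n) := by
    by_contra! hm
    exact hu (hD.eventually_const hm)
  refine ⟨n, ?_⟩
  by_contra! hx
  have hpos : ∀ i, 0 < x n i := fun i => lt_of_le_of_ne (h.nonneg n i) (Ne.symm (hx i))
  have key : ∀ a b c : ℤ, ¬(a = 0 ∧ b = 0 ∧ c = 0) → 0 ≤ a → 0 ≤ b → 0 ≤ c →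
      0 < (a : ℝ) * x n 0 + b * x n 1 + c * x n 2 := by
    intro a b c h0 ha hb hc
    have p0 := hpos 0
    have p1 := hpos 1
    have p2 := hpos 2
    have ha' : (0 : ℝ) ≤ a := by exact_mod_cast ha
    have hb' : (0 : ℝ) ≤ b := by exact_mod_cast hb
    have hc' : (0 : ℝ) ≤ c := by exact_mod_cast hc
    rcases (by omega : 0 < a ∨ 0 < b ∨ 0 < c) with h | h | h
    · have : (0 : ℝ) < a := by exact_mod_cast h
      positivity
    · have : (0 : ℝ) < b := by exact_mod_cast h
      positivity
    · have : (0 : ℝ) < c := by exact_mod_cast h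
      positivity
  have hn0 := hne n
  have hd := hdot n
  unfold Mixed at hn
  rcases (by omega : (0 ≤ a n ∧ 0 ≤ b n ∧ 0 ≤ c n) ∨ (0 ≤ -a n ∧ 0 ≤ -b n ∧ 0 ≤ -c n)) with
    ⟨h0, h1, h2⟩ | ⟨h0, h1, h2⟩
  · have := key _ _ _ hn0 h0 h1 h2
    linarith
  · have := key _ _ _ (by omega) h0 h1 h2
    push_cast at this
    linarith

lemma exists_middle_eq_zero (h : Orbit u x) {n : ℕ} {i : Fin 3} (hi : x n i = 0) :
    ∃ N, x N 1 = 0 := by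
  have p := h.nonneg (n + 1)
  have p0 := p 0
  have p1 := p 1
  have p2 := p 2
  by_cases hu : u n
  · obtain ⟨h0, h1, h2⟩ := h.left n hu
    fin_cases i
    · exact ⟨n + 1, by simp at hi; linarith⟩
    · exact ⟨n, hi⟩
    · exact ⟨n + 1, by simp at hi; linarith⟩
  · obtain ⟨h0, h1, h2⟩ := h.right n hu
    fin_cases i
    · exact ⟨n + 1, by simp at hi; linarith⟩
    · exact ⟨n, hi⟩
    · exact ⟨n + 1, by simp at hi; linarith⟩

lemma pair_of_middle_eq_zero (h : Orbit u x) (hd : 1 < dimQ (x 0)) {n : ℕ} (hn : x n 1 = 0) :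
    (u n ↔ u (n + 1)) ∧ x (n + 1 + 1) 1 = 0 := by
  have hd' : ∀ m k, ¬∀ i, i ≠ k → x m i = 0 := fun m k hk =>
    absurd (dimQ_le_one k hk) (by rw [h.dimQ_eq]; omega)
  have p0 := h.nonneg (n + 1 + 1) 0
  have p1 := h.nonneg (n + 1 + 1) 1
  have p2 := h.nonneg (n + 1 + 1) 2
  by_cases hu : u n <;> by_cases hu' : u (n + 1)
  · obtain ⟨h0, h1, h2⟩ := h.left n hu
    obtain ⟨e0, e1, e2⟩ := h.left _ hu'
    exact ⟨by tauto, by linarith⟩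
  · obtain ⟨h0, h1, h2⟩ := h.left n hu
    obtain ⟨e0, e1, e2⟩ := h.right _ hu'
    refine absurd (fun i hi => ?_) (hd' (n + 1) 1)
    fin_cases i
    · simp; linarith
    · simp at hi
    · simp; linarith
  · obtain ⟨h0, h1, h2⟩ := h.right n hu
    obtain ⟨e0, e1, e2⟩ := h.left _ hu'
    refine absurd (fun i hi => ?_) (hd' (n + 1) 1)
    fin_cases i
    · simp; linarith
    · simp at hi
    · simp; linarith
  · obtain ⟨h0, h1, h2⟩ := h.right n hu
    obtain ⟨e0, e1, e2⟩ := h.right _ hu'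
    exact ⟨by tauto, by linarith⟩

theorem exists_paired (h : Orbit u x) (hd : dimQ (x 0) = 2) :
    ∃ N, ∀ i, (u (N + 2 * i) ↔ u (N + 2 * i + 1)) := by
  have hu : ¬∃ N, (∀ n ≥ N, u n) ∨ ∀ n ≥ N, ¬u n := fun ⟨N, hN⟩ => by
    have := h.dimQ_le_one_of_eventually_const hN
    omega
  obtain ⟨n, i, hi⟩ := h.exists_eq_zero hu (by omega)
  obtain ⟨N, hN⟩ := h.exists_middle_eq_zero hi
  have hz : ∀ i, x (N + 2 * i) 1 = 0 := by
    intro i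
    induction i with
    | zero => exact hN
    | succ i ih => exact (h.pair_of_middle_eq_zero (by omega) ih).2
  exact ⟨N, fun i => (h.pair_of_middle_eq_zero (by omega) (hz i)).1⟩

lemma two_steps (h : Orbit u x) {n : ℕ} (hn : u n ↔ u (n + 1)) :
    x (n + 2) 1 = x n 1 ∧
      ((u n ∧ x (n + 2) 0 = x n 0 - x n 2 - x n 1 ∧ x (n + 2) 2 = x n 2) ∨
        (¬u n ∧ x (n + 2) 0 = x n 0 ∧ x (n + 2) 2 = x n 2 - x n 0 - x n 1)) := by
  by_cases hu : u n
  · obtain ⟨h0, h1, h2⟩ := h.left n hu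
    obtain ⟨e0, e1, e2⟩ := h.left _ (hn.1 hu)
    exact ⟨by linarith, Or.inl ⟨hu, by linarith, by linarith⟩⟩
  · obtain ⟨h0, h1, h2⟩ := h.right n hu
    obtain ⟨e0, e1, e2⟩ := h.right _ (mt hn.2 hu)
    exact ⟨by linarith, Or.inr ⟨hu, by linarith, by linarith⟩⟩

lemma middle_eq_zero (h : Orbit u x) {N : ℕ} (hN : ∀ i, (u (N + 2 * i) ↔ u (N + 2 * i + 1))) :
    ∀ i, x (N + 2 * i) 1 = 0 := by
  have hc : ∀ i, x (N + 2 * i) 1 = x N 1 := by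
    intro i
    induction i with
    | zero => rfl
    | succ i ih => rw [← ih]; exact (h.two_steps (hN i)).1
  have hsum : ∀ i : ℕ, x (N + 2 * i) 0 + x (N + 2 * i) 2 + i * x N 1 ≤ x N 0 + x N 2 := by
    intro i
    induction i with
    | zero => simp
    | succ i ih =>
      have h1 := (h.two_steps (hN i)).2
      have p0 := h.nonneg (N + 2 * i) 0
      have p2 := h.nonneg (N + 2 * i) 2
      rw [hc i] at h1
      rw [show N + 2 * (i + 1) = N + 2 * i + 2 by ring]
      push_cast
      rcases h1 with ⟨-, h2, h3⟩ | ⟨-, h2, h3⟩ <;> linarith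
  have h0 : x N 1 = 0 := by
    by_contra hne
    obtain ⟨k, hk⟩ := exists_lt_nsmul (lt_of_le_of_ne (h.nonneg N 1) (Ne.symm hne)) (x N 0 + x N 2)
    rw [nsmul_eq_mul] at hk
    have := hsum k
    have := h.nonneg (N + 2 * k) 0
    have := h.nonneg (N + 2 * k) 2
    linarith
  exact fun i => (hc i).trans h0

lemma forall_left_of_right_eq_zero (h : Orbit u x) (h0 : x 0 ≠ 0) {N : ℕ}
    (hN : ∀ i, (u (N + 2 * i) ↔ u (N + 2 * i + 1))) (hz : x N 2 = 0) : ∀ n ≥ N, u n := by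
  have hmid := h.middle_eq_zero hN
  have key : ∀ i, x (N + 2 * i) 2 = 0 → u (N + 2 * i) ∧ x (N + 2 * (i + 1)) 2 = 0 := by
    intro i hi
    rcases (h.two_steps (hN i)).2 with ⟨hu, -, h2⟩ | ⟨-, h1, h2⟩
    · exact ⟨hu, h2.trans hi⟩
    · have p0 := h.nonneg (N + 2 * i) 0
      have p2 := h.nonneg (N + 2 * i + 2) 2
      have hm := hmid i
      refine absurd ?_ (h.ne_zero h0 (N + 2 * i))
      ext j
      fin_cases j
      · simp; linarith
      · exact hm
      · exact hi
  have hz' : ∀ i, x (N + 2 * i) 2 = 0 := by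
    intro i
    induction i with
    | zero => exact hz
    | succ i ih => exact (key i ih).2
  intro n hn
  have hu := fun i => (key i (hz' i)).1
  rcases Nat.even_or_odd' (n - N) with ⟨k, hk | hk⟩
  · rw [show n = N + 2 * k by omega]
    exact hu k
  · rw [show n = N + 2 * k + 1 by omega]
    exact (hN k).1 (hu k)

lemma exists_eq_zero_of_paired_of_relation (h : Orbit u x) {N : ℕ}
    (hN : ∀ i, (u (N + 2 * i) ↔ u (N + 2 * i + 1))) {p q : ℤ} (hpq : ¬(p = 0 ∧ q = 0))
    {j : ℕ} (hrel : p * x (N + 2 * j) 0 + q * x (N + 2 * j) 2 = 0) :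
    ∃ i, x (N + 2 * i) 0 = 0 ∨ x (N + 2 * i) 2 = 0 := by
  by_contra! hne
  have hpos : ∀ i, 0 < x (N + 2 * i) 0 ∧ 0 < x (N + 2 * i) 2 := fun i =>
    ⟨lt_of_le_of_ne (h.nonneg _ _) (Ne.symm (hne i).1),
      lt_of_le_of_ne (h.nonneg _ _) (Ne.symm (hne i).2)⟩
  have hopp : ∀ (p q : ℤ) (i : ℕ), ¬(p = 0 ∧ q = 0) →
      p * x (N + 2 * i) 0 + q * x (N + 2 * i) 2 = 0 → (0 < p ∧ q < 0) ∨ (p < 0 ∧ 0 < q) := by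
    intro p q i hpq hrel
    obtain ⟨hx, hz⟩ := hpos i
    rcases lt_trichotomy p 0 with hp | hp | hp
    · have hp' : (p : ℝ) < 0 := by exact_mod_cast hp
      have : 0 < (q : ℝ) := by
        by_contra! hq
        nlinarith [mul_neg_of_neg_of_pos hp' hx, mul_nonneg (neg_nonneg.2 hq) hz.le]
      exact Or.inr ⟨hp, by exact_mod_cast this⟩
    · subst hp
      have : (q : ℝ) = 0 := by simpa [hz.ne'] using hrel
      exact absurd ⟨rfl, by exact_mod_cast this⟩ hpq
    · have hp' : 0 < (p : ℝ) := by exact_mod_cast hp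
      have : (q : ℝ) < 0 := by
        by_contra! hq
        nlinarith [mul_pos hp' hx, mul_nonneg hq hz.le]
      exact Or.inl ⟨hp, by exact_mod_cast this⟩
  have key : ∀ (m : ℕ) (p q : ℤ) (i : ℕ), p.natAbs + q.natAbs = m → ¬(p = 0 ∧ q = 0) →
      (p : ℝ) * x (N + 2 * i) 0 + q * x (N + 2 * i) 2 ≠ 0 := by
    intro m
    induction m using Nat.strong_induction_on with
    | _ m ih =>
      intro p q i hm hpq hrel
      have hsign := hopp p q i hpq hrel
      have hmid := h.middle_eq_zero hN i
      rcases (h.two_steps (hN i)).2 with ⟨-, h1, h2⟩ | ⟨-, h1, h2⟩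
      · have hrel' : ((p : ℤ) : ℝ) * x (N + 2 * (i + 1)) 0 +
            (p + q : ℤ) * x (N + 2 * (i + 1)) 2 = 0 := by
          rw [show N + 2 * (i + 1) = N + 2 * i + 2 by ring, h1, h2, hmid]
          push_cast
          linarith
        have hsign' := hopp _ _ _ (by omega) hrel'
        exact ih _ (by omega) _ _ _ rfl (by omega) hrel'
      · have hrel' : ((p + q : ℤ) : ℝ) * x (N + 2 * (i + 1)) 0 +
            (q : ℤ) * x (N + 2 * (i + 1)) 2 = 0 := by
          rw [show N + 2 * (i + 1) = N + 2 * i + 2 by ring, h1, h2, hmid]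
          push_cast
          linarith
        have hsign' := hopp _ _ _ (by omega) hrel'
        exact ih _ (by omega) _ _ _ rfl (by omega) hrel'
  exact key _ p q j rfl hpq hrel

theorem dimQ_eq_two_of_paired (h : Orbit u x) (h0 : x 0 ≠ 0) {N : ℕ}
    (hN : ∀ i, (u (N + 2 * i) ↔ u (N + 2 * i + 1)))
    (hu : ¬∃ N, (∀ n ≥ N, u n) ∨ ∀ n ≥ N, ¬u n) : dimQ (x 0) = 2 := by
  rw [← h.dimQ_eq N]
  refine dimQ_eq_two (h.middle_eq_zero hN 0) fun p q hrel => ?_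
  by_contra hpq
  obtain ⟨i, hi⟩ := h.exists_eq_zero_of_paired_of_relation hN hpq (j := 0) hrel
  have hN' : ∀ j, (u (N + 2 * i + 2 * j) ↔ u (N + 2 * i + 2 * j + 1)) := by
    intro j
    rw [show N + 2 * i + 2 * j = N + 2 * (i + j) by ring]
    exact hN (i + j)
  refine hu ⟨N + 2 * i, ?_⟩
  rcases hi with hi | hi
  · refine Or.inr (h.swap.forall_left_of_right_eq_zero (fun h1 => h0 ?_)
      (fun j => not_congr (hN' j)) hi)
    ext j
    fin_cases j
    · exact congrFun h1 2
    · exact congrFun h1 1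
    · exact congrFun h1 0
  · exact Or.inl (h.forall_left_of_right_eq_zero h0 hN' hi)

end Orbit

lemma isUnit_det_pprod {M : ℕ → Matrix (Fin 3) (Fin 3) ℝ} (hM : ∀ n, M n = C1 ∨ M n = C2) (n : ℕ) :
    IsUnit (pprod M n).det := by
  induction n with
  | zero => simp [pprod]
  | succ n ih =>
    have : pprod M (n + 1) = pprod M n * M n := by simp [pprod, List.range_succ]
    rw [this, det_mul]
    refine ih.mul ?_
    rcases hM n with h | h <;> rw [h] <;> simp [C1, C2, det_fin_three]

lemma exists_orbit {M : ℕ → Matrix (Fin 3) (Fin 3) ℝ} (hM : ∀ n, M n = C1 ∨ M n = C2)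
    {f : Fin 3 → ℝ} (hf : ∀ n, f ∈ cone (pprod M n)) :
    ∃ x, Orbit (fun n => M n = C1) x ∧ x 0 = f := by
  choose x hx hfx using hf
  have hstep : ∀ n, x n = M n *ᵥ x (n + 1) := by
    intro n
    have hinj := mulVec_injective_of_isUnit ((isUnit_iff_isUnit_det _).2 (isUnit_det_pprod hM n))
    apply hinj
    show pprod M n *ᵥ x n = pprod M n *ᵥ (M n *ᵥ x (n + 1))
    rw [mulVec_mulVec, ← hfx n, hfx (n + 1)]
    simp [pprod, List.range_succ]
  refine ⟨x, ⟨hx, fun n hn => ?_, fun n hn => ?_⟩, ?_⟩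
  · have h := hstep n
    rw [hn] at h
    have e := congrFun h
    exact ⟨by simpa [C1, mulVec, dotProduct, Fin.sum_univ_three] using e 0,
      by simpa [C1, mulVec, dotProduct, Fin.sum_univ_three] using e 1,
      by simpa [C1, mulVec, dotProduct, Fin.sum_univ_three] using e 2⟩
  · have h := hstep n
    rw [(hM n).resolve_left hn] at h
    have e := congrFun h
    exact ⟨by simpa [C2, mulVec, dotProduct, Fin.sum_univ_three] using e 0,
      by simpa [C2, mulVec, dotProduct, Fin.sum_univ_three] using e 1,
      by simpa [C2, mulVec, dotProduct, Fin.sum_univ_three] using e 2⟩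
  · rw [hfx 0]
    simp [pprod]

lemma C1_ne_C2 : C1 ≠ C2 := fun h => by
  have := congrFun (congrFun h 0) 0
  simp [C1, C2] at this

theorem dimQ_eq_two_iff
    (M : ℕ → Matrix (Fin 3) (Fin 3) ℝ) (hM : ∀ n, M n = C1 ∨ M n = C2)
    (f : Fin 3 → ℝ) (hf : f ∈ simplex)
    (hcone : (⋂ n : ℕ, cone (pprod M n)) = ray f) :
    dimQ f = 2 ↔
      ((∃ N : ℕ, ∀ i : ℕ, M (N + 2 * i) = M (N + 2 * i + 1)) ∧
        ¬∃ N' : ℕ, ∀ n ≥ N', M n = M N') := by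
  have hmem : f ∈ ⋂ n : ℕ, cone (pprod M n) := by
    rw [hcone]
    exact ⟨1, zero_le_one, (one_smul ℝ f).symm⟩
  obtain ⟨x, hx, rfl⟩ := exists_orbit hM (Set.mem_iInter.1 hmem)
  have h0 : x 0 ≠ 0 := by
    intro h
    have := hf.2
    simp [h] at this
  have heq : ∀ m n, M m = M n ↔ (M m = C1 ↔ M n = C1) := by
    intro m n
    have := C1_ne_C2
    rcases hM m with h | h <;> rcases hM n with h' | h' <;> simp [h, h', this, this.symm]
  have hconst : (∃ N', ∀ n ≥ N', M n = M N') ↔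
      ∃ N, (∀ n ≥ N, M n = C1) ∨ ∀ n ≥ N, ¬M n = C1 := by
    constructor
    · rintro ⟨N, hN⟩
      refine ⟨N, ?_⟩
      by_cases h : M N = C1
      · exact Or.inl fun n hn => (hN n hn).trans h
      · exact Or.inr fun n hn => by rwa [hN n hn]
    · rintro ⟨N, hN | hN⟩
      · exact ⟨N, fun n hn => (hN n hn).trans (hN N le_rfl).symm⟩
      · exact ⟨N, fun n hn => (heq n N).2 (iff_of_false (hN n hn) (hN N le_rfl))⟩
  rw [hconst]
  constructor
  · intro hd
    refine ⟨?_, fun ⟨N, hN⟩ => ?_⟩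
    · obtain ⟨N, hN⟩ := hx.exists_paired hd
      exact ⟨N, fun i => (heq _ _).2 (hN i)⟩
    · have := hx.dimQ_le_one_of_eventually_const hN
      omega
  · rintro ⟨⟨N, hN⟩, hu⟩
    exact hx.dimQ_eq_two_of_paired h0 (fun i => (heq _ _).1 (hN i)) hu
end
end

section
/- Let (M_n)_{n∈ℕ} ∈ {C1,C2}^ℕ be a sequence containing infinitely many occurrences of C1 and infinitely many occurrences of C2. Then there exists a strictly increasing sequence of integers (n_m)_{m∈ℕ} with n_0 = 0 such that for every m ∈ ℕ, the product M_{n_m} M_{n_m+1} ⋯ M_{n_{m+1}−1} belongs to the set {C1 C2^k C1 : k ∈ ℕ} ∪ {C2 C1^k C2 : k ∈ ℕ}. -/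
open Matrix Filter MeasureTheory

noncomputable section

/-- The product `M r * M (r+1) * ... * M (s-1)`. -/
def segProd (M : ℕ → Matrix (Fin 3) (Fin 3) ℝ) (r s : ℕ) : Matrix (Fin 3) (Fin 3) ℝ :=
  ((List.range (s - r)).map (fun k => M (r + k))).prod

/-- A segment whose interior factors all equal `B` multiplies to an outer-inner-outer product. -/
theorem segProd_of_interior_eq (M : ℕ → Matrix (Fin 3) (Fin 3) ℝ)
    (B : Matrix (Fin 3) (Fin 3) ℝ) (r k : ℕ) (h : ∀ j < k, M (r + (j + 1)) = B) :
    segProd M r (r + (k + 2)) = M r * B ^ k * M (r + (k + 1)) := by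
  have hmap : (List.range k).map (fun j => M (r + (j + 1))) = List.replicate k B := by
    rw [List.eq_replicate_iff]
    simpa using h
  rw [segProd, Nat.add_sub_cancel_left, List.range_succ, List.map_append, List.prod_append,
    List.range_succ_eq_map, List.map_cons, List.prod_cons, List.map_map]
  simp [Function.comp_def, hmap]

/-- In a sequence with values in `{A, B}` that takes the value `A` infinitely often, every segment
start carrying `A` can be completed to a block `A * B ^ k * A`. -/
theorem exists_segProd_eq_block (M : ℕ → Matrix (Fin 3) (Fin 3) ℝ)
    (A B : Matrix (Fin 3) (Fin 3) ℝ) (hM : ∀ n, M n = A ∨ M n = B)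
    (hA : ∀ N : ℕ, ∃ n ≥ N, M n = A) (r : ℕ) (hr : M r = A) :
    ∃ s > r, ∃ k : ℕ, segProd M r s = A * B ^ k * A := by
  classical
  have hex : ∃ k, M (r + (k + 1)) = A := by
    obtain ⟨n, hn, hnA⟩ := hA (r + 1)
    obtain ⟨k, rfl⟩ := Nat.exists_eq_add_of_le hn
    exact ⟨k, by rwa [← add_assoc, add_right_comm]⟩
  refine ⟨r + (Nat.find hex + 2), by lia, Nat.find hex, ?_⟩
  rw [segProd_of_interior_eq M B r _ fun j hj => (hM _).resolve_left (Nat.find_min hex hj),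
    hr, Nat.find_spec hex]

theorem factorization_into_C1C2kC1_blocks (M : ℕ → Matrix (Fin 3) (Fin 3) ℝ)
    (hM : ∀ n, M n = C1 ∨ M n = C2)
    (h1 : ∀ N : ℕ, ∃ n ≥ N, M n = C1) (h2 : ∀ N : ℕ, ∃ n ≥ N, M n = C2) :
    ∃ ns : ℕ → ℕ, ns 0 = 0 ∧ StrictMono ns ∧
      ∀ m : ℕ, ∃ k : ℕ,
        segProd M (ns m) (ns (m + 1)) = C1 * C2 ^ k * C1 ∨
        segProd M (ns m) (ns (m + 1)) = C2 * C1 ^ k * C2 := by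
  have hblock : ∀ r, ∃ s > r, ∃ k : ℕ,
      segProd M r s = C1 * C2 ^ k * C1 ∨ segProd M r s = C2 * C1 ^ k * C2 := by
    intro r
    rcases hM r with hr | hr
    · obtain ⟨s, hs, k, hk⟩ := exists_segProd_eq_block M C1 C2 hM h1 r hr
      exact ⟨s, hs, k, Or.inl hk⟩
    · obtain ⟨s, hs, k, hk⟩ := exists_segProd_eq_block M C2 C1 (fun n => (hM n).symm) h2 r hr
      exact ⟨s, hs, k, Or.inr hk⟩
  choose next hlt hnext using hblock
  refine ⟨fun m => next^[m] 0, rfl, strictMono_nat_of_lt_succ fun m => ?_, fun m => ?_⟩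
  · simpa only [Function.iterate_succ_apply'] using hlt _
  · simpa only [Function.iterate_succ_apply'] using hnext _
end
end
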